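/- arXiv:2512.22362 — 10 statements merged into one kernel-verified Lean document; each statement's English description precedes it below -/
import Mathlib

section
/- For every natural number n ≥ 1, C_A(n) = 3^(3n−2) + (1 + (−1)^n)·i^n·3^((3n−2)/2); equivalently, in real terms: if n is odd then C_A(n) = 3^(3n−2), and if n is even then C_A(n) = 3^(3n−2) + 2·(−1)^(n/2)·3^((3n−2)/2). -/
open Nat Finset

/-- `CA n` is the number of words of length `3n` over a three-letter alphabet in which
each letter occurs a number of times divisible by 3:
the sum over triples `k1 + k2 + k3 = n` of `(3n)! / ((3k1)! (3k2)! (3k3)!)`. -/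
def CA (n : ℕ) : ℕ :=
  ∑ k ∈ Finset.Nat.antidiagonalTuple 3 n,
    (3 * n)! / ((3 * k 0)! * (3 * k 1)! * (3 * k 2)!)

theorem CA_eq_sum_choose_mul_sum_choose (n : ℕ) :
    CA n = ∑ k ∈ range (n + 1), (3 * n).choose (3 * k) *
      ∑ j ∈ range (n - k + 1), (3 * (n - k)).choose (3 * j) := by
  simp_rw [CA, mul_sum]
  rw [sum_sigma']
  refine sum_bij' (fun k _ ↦ ⟨k 0, k 1⟩) (fun p _ ↦ ![p.1, p.2, n - p.1 - p.2]) ?_ ?_ ?_ ?_ ?_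
  · intro k hk
    simp only [Finset.Nat.mem_antidiagonalTuple, Fin.sum_univ_three] at hk
    simp only [mem_sigma, mem_range]
    omega
  · rintro ⟨a, b⟩ hp
    simp only [mem_sigma, mem_range] at hp
    simp only [Finset.Nat.mem_antidiagonalTuple, Fin.sum_univ_three, Matrix.cons_val]
    omega
  · intro k hk
    simp only [Finset.Nat.mem_antidiagonalTuple, Fin.sum_univ_three] at hk
    ext i
    fin_cases i <;> simp
    omega
  · rintro ⟨a, b⟩ _
    simp
  · intro k hk
    simp only [Finset.Nat.mem_antidiagonalTuple, Fin.sum_univ_three] at hk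
    have h₁ := Nat.choose_mul_factorial_mul_factorial (show 3 * k 0 ≤ 3 * n by omega)
    have h₂ := Nat.choose_mul_factorial_mul_factorial (show 3 * k 1 ≤ 3 * (n - k 0) by omega)
    rw [show 3 * n - 3 * k 0 = 3 * (n - k 0) by omega] at h₁
    rw [show 3 * (n - k 0) - 3 * k 1 = 3 * k 2 by omega] at h₂
    refine Nat.div_eq_of_eq_mul_left (by positivity) ?_
    rw [← h₁, ← h₂]
    ring

section CubeRoot

variable {R : Type*} [CommRing R] {ω : R}

theorem one_add_pow_add_sq_pow_of_cube_root (hω : ω ^ 2 + ω + 1 = 0) (m : ℕ) :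
    1 + ω ^ m + (ω ^ 2) ^ m = if 3 ∣ m then 3 else 0 := by
  have h3 : ω ^ 3 = 1 := by linear_combination (ω - 1) * hω
  have h (q r : ℕ) : ω ^ (3 * q + r) = ω ^ r := by rw [pow_add, pow_mul, h3, one_pow, one_mul]
  rw [← pow_mul, mul_comm 2 m, pow_mul, ← Nat.div_add_mod m 3, h]
  have := Nat.mod_lt m (show 3 > 0 by simp)
  simp only [Nat.dvd_add_right (dvd_mul_right 3 (m / 3))]
  interval_cases m % 3
  · norm_num
  · norm_num; linear_combination hω
  · norm_num; linear_combination (ω ^ 2 - ω + 1) * hω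

theorem sum_range_ite_three_dvd (n : ℕ) (f : ℕ → R) :
    ∑ m ∈ range (3 * n + 1), (if 3 ∣ m then f m else 0) = ∑ k ∈ range (n + 1), f (3 * k) := by
  induction n with
  | zero => simp
  | succ n ih =>
    rw [show 3 * (n + 1) + 1 = 3 * n + 1 + 1 + 1 + 1 by ring, sum_range_succ, sum_range_succ,
      sum_range_succ, ih, sum_range_succ _ (n + 1), if_neg (by omega), if_neg (by omega),
      if_pos (by omega), add_zero, add_zero, show 3 * n + 1 + 1 + 1 = 3 * (n + 1) by ring]

theorem three_mul_sum_choose_three_mul (hω : ω ^ 2 + ω + 1 = 0) (n : ℕ) (y : R) :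
    3 * ∑ k ∈ range (n + 1), ((3 * n).choose (3 * k) : R) * y ^ (3 * (n - k)) =
      ((1 + y) ^ 3) ^ n + ((ω + y) ^ 3) ^ n + ((ω ^ 2 + y) ^ 3) ^ n := by
  simp_rw [← pow_mul, add_pow, Nat.mul_sub]
  rw [← sum_range_ite_three_dvd n fun m ↦ ((3 * n).choose m : R) * y ^ (3 * n - m), mul_sum,
    ← sum_add_distrib, ← sum_add_distrib]
  refine sum_congr rfl fun m _ ↦ ?_
  have h := one_add_pow_add_sq_pow_of_cube_root hω m
  split_ifs at h ⊢ <;>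
    linear_combination -(y ^ (3 * n - m) * ((3 * n).choose m : R)) * h

theorem three_mul_sum_choose (hω : ω ^ 2 + ω + 1 = 0) (n : ℕ) :
    3 * ∑ k ∈ range (n + 1), ((3 * n).choose (3 * k) : R) = 2 ^ (3 * n) + 2 * (-1) ^ (3 * n) := by
  have h := three_mul_sum_choose_three_mul hω n 1
  have e₁ : (ω + 1) ^ 3 = (-1) ^ 3 := by linear_combination (ω + 2) * hω
  have e₂ : (ω ^ 2 + 1) ^ 3 = (-1) ^ 3 := by
    linear_combination (ω ^ 4 - ω ^ 3 + 3 * ω ^ 2 - 2 * ω + 2) * hω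
  simp only [one_pow, mul_one, e₁, e₂, one_add_one_eq_two, ← pow_mul] at h
  rw [h]
  ring

theorem nine_mul_CA (hω : ω ^ 2 + ω + 1 = 0) {n : ℕ} (hn : n ≠ 0) :
    9 * (CA n : R) = 27 ^ n + 3 * ((3 + 6 * ω) ^ n + (-(3 + 6 * ω)) ^ n) := by
  have h₂ := three_mul_sum_choose_three_mul hω n 2
  have h₁ := three_mul_sum_choose_three_mul hω n (-1)
  have e₁ : (ω + 2) ^ 3 = 3 + 6 * ω := by linear_combination (ω + 5) * hω
  have e₂ : (ω ^ 2 + 2) ^ 3 = -(3 + 6 * ω) := by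
    linear_combination (ω ^ 4 - ω ^ 3 + 6 * ω ^ 2 - 5 * ω + 11) * hω
  have e₃ : (ω + -1) ^ 3 = 3 + 6 * ω := by linear_combination (ω - 4) * hω
  have e₄ : (ω ^ 2 + -1) ^ 3 = -(3 + 6 * ω) := by
    linear_combination (ω ^ 4 - ω ^ 3 - 3 * ω ^ 2 + 4 * ω + 2) * hω
  rw [e₁, e₂] at h₂
  rw [e₃, e₄, add_neg_cancel, zero_pow three_ne_zero, zero_pow hn] at h₁
  have key : 3 * (CA n : R) =
      ∑ k ∈ range (n + 1), ((3 * n).choose (3 * k) : R) * 2 ^ (3 * (n - k)) +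
      2 * ∑ k ∈ range (n + 1), ((3 * n).choose (3 * k) : R) * (-1) ^ (3 * (n - k)) := by
    rw [CA_eq_sum_choose_mul_sum_choose, mul_sum, ← sum_add_distrib]
    push_cast
    rw [mul_sum]
    refine sum_congr rfl fun k _ ↦ ?_
    linear_combination ((3 * n).choose (3 * k) : R) * three_mul_sum_choose hω (n - k)
  norm_num at h₂
  linear_combination 3 * key + h₂ + 2 * h₁

end CubeRoot

theorem exists_complex_sq_add_self_add_one_eq_zero : ∃ ω : ℂ, ω ^ 2 + ω + 1 = 0 := by
  obtain ⟨s, hs⟩ := IsAlgClosed.exists_pow_nat_eq (-3 : ℂ) (show 0 < 2 by simp)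
  exact ⟨(s - 1) / 2, by linear_combination hs / 4⟩

theorem CA_of_odd {n : ℕ} (hn : Odd n) : CA n = 3 ^ (3 * n - 2) := by
  obtain ⟨ω, hω⟩ := exists_complex_sq_add_self_add_one_eq_zero
  have h := nine_mul_CA hω hn.pos.ne'
  rw [hn.neg_pow, add_neg_cancel, mul_zero, add_zero] at h
  norm_cast at h
  have e : 27 ^ n = 9 * 3 ^ (3 * n - 2) := by
    rw [show 27 = 3 ^ 3 by rfl, ← pow_mul, show 9 = 3 ^ 2 by rfl, ← pow_add]
    congr 1
    have := hn.pos
    omega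
  omega

theorem CA_two_mul {m : ℕ} (hm : m ≠ 0) :
    (CA (2 * m) : ℤ) = 3 ^ (6 * m - 2) + 2 * (-1) ^ m * 3 ^ (3 * m - 1) := by
  obtain ⟨ω, hω⟩ := exists_complex_sq_add_self_add_one_eq_zero
  have h : 9 * (CA (2 * m) : ℤ) = 27 ^ (2 * m) + 6 * (-27) ^ m := by
    have h := nine_mul_CA hω (mul_ne_zero two_ne_zero hm)
    rw [(even_two_mul m).neg_pow, pow_mul (3 + 6 * ω),
      show (3 + 6 * ω) ^ 2 = -27 by linear_combination 36 * hω] at h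
    apply Int.cast_injective (α := ℂ)
    push_cast
    linear_combination h
  obtain ⟨k, rfl⟩ := Nat.exists_eq_add_one_of_ne_zero hm
  rw [show 6 * (k + 1) - 2 = 3 * (2 * k) + 4 by omega, show 3 * (k + 1) - 1 = 3 * k + 2 by omega,
    pow_add 3 (3 * (2 * k)), pow_add 3 (3 * k), pow_mul _ 3, pow_mul _ 3,
    show (3 : ℤ) ^ 3 = 27 by rfl]
  have e : (-27 : ℤ) ^ (k + 1) = (-1) ^ (k + 1) * 27 ^ (k + 1) := by
    rw [← mul_pow, neg_one_mul]
  rw [e] at h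
  refine mul_left_cancel₀ (show (9 : ℤ) ≠ 0 by simp) (h.trans ?_)
  ring

theorem stmt_0 (n : ℕ) (hn : 1 ≤ n) :
    (CA n : ℂ) = 3 ^ (3 * n - 2) +
      (1 + (-1 : ℂ) ^ n) * Complex.I ^ n * (3 : ℂ) ^ ((3 * (n : ℂ) - 2) / 2) ∧
    (Odd n → (CA n : ℤ) = 3 ^ (3 * n - 2)) ∧
    (Even n →
      (CA n : ℤ) = 3 ^ (3 * n - 2) + 2 * (-1) ^ (n / 2) * 3 ^ ((3 * n - 2) / 2)) := by
  have hodd (h : Odd n) : (CA n : ℤ) = 3 ^ (3 * n - 2) := by exact_mod_cast CA_of_odd h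
  have heven (h : Even n) :
      (CA n : ℤ) = 3 ^ (3 * n - 2) + 2 * (-1) ^ (n / 2) * 3 ^ ((3 * n - 2) / 2) := by
    obtain ⟨m, rfl⟩ := h.exists_two_nsmul
    rw [smul_eq_mul] at hn ⊢
    rw [CA_two_mul (by omega), show 3 * (2 * m) - 2 = 6 * m - 2 by omega,
      show 2 * m / 2 = m by omega, show (6 * m - 2) / 2 = 3 * m - 1 by omega]
  refine ⟨?_, hodd, heven⟩
  rcases Nat.even_or_odd n with h | h
  · have hC : (CA n : ℂ) =
        3 ^ (3 * n - 2) + 2 * (-1) ^ (n / 2) * 3 ^ ((3 * n - 2) / 2) := by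
      exact_mod_cast congrArg (Int.cast : ℤ → ℂ) (heven h)
    have hI : Complex.I ^ n = (-1) ^ (n / 2) := by
      rw [← Complex.I_sq, ← pow_mul, Nat.two_mul_div_two_of_even h]
    have he : (3 * (n : ℂ) - 2) / 2 = ((3 * n - 2) / 2 : ℕ) := by
      rw [Nat.cast_div_charZero (by have := h.two_dvd; omega), Nat.cast_sub (by omega)]
      push_cast
      rfl
    rw [hC, hI, he, Complex.cpow_natCast, h.neg_one_pow]
    ring
  · rw [h.neg_one_pow, CA_of_odd h]
    simp
end

section
/- For every natural number n ≥ 1, C_C(n) = 3^(3n−2) − ((1 + (−1)^n) − i·√3·(1 − (−1)^n))·(i^n/2)·3^((3n−2)/2); equivalently, in real terms: if n is even then C_C(n) = 3^(3n−2) − (−1)^(n/2)·3^((3n−2)/2), and if n is odd then C_C(n) = 3^(3n−2) + (−1)^((n+1)/2)·3^((3n−1)/2). -/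
open Nat Finset

/-- `CC n` is the number of words of length `3n` over a three-letter alphabet in which
each letter occurs a number of times congruent to 2 mod 3:
the sum over triples `k1 + k2 + k3 = n - 2` of `(3n)! / ((3k1+2)! (3k2+2)! (3k3+2)!)`,
with `CC 0 = CC 1 = 0`. -/
def CC (n : ℕ) : ℕ :=
  if n ≤ 1 then 0 else
    ∑ k ∈ Finset.Nat.antidiagonalTuple 3 (n - 2),
      (3 * n)! / ((3 * k 0 + 2)! * (3 * k 1 + 2)! * (3 * k 2 + 2)!)

theorem CC_eq_sum_multinomial (n : ℕ) :
    CC n = ∑ k ∈ (piAntidiag (univ : Finset (Fin 3)) (3 * n)) with (∀ i, k i % 3 = 2),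
      Nat.multinomial univ k := by
  unfold CC
  split_ifs with h
  · symm
    apply sum_eq_zero
    intro k hk
    simp only [mem_filter, mem_piAntidiag, Fin.sum_univ_three] at hk
    have h0 := hk.2 0
    have h1 := hk.2 1
    have h2 := hk.2 2
    omega
  · refine sum_nbij' (fun k i => 3 * k i + 2) (fun k i => k i / 3) ?_ ?_ ?_ ?_ ?_
    · intro k hk
      simp only [Finset.Nat.mem_antidiagonalTuple, Fin.sum_univ_three] at hk
      simp only [mem_filter, mem_piAntidiag, Fin.sum_univ_three]
      refine ⟨⟨by omega, by simp⟩, fun i => by omega⟩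
    · intro k hk
      simp only [mem_filter, mem_piAntidiag, Fin.sum_univ_three] at hk
      simp only [Finset.Nat.mem_antidiagonalTuple, Fin.sum_univ_three]
      have h0 := hk.2 0
      have h1 := hk.2 1
      have h2 := hk.2 2
      omega
    · intro k _
      funext i
      dsimp only
      omega
    · intro k hk
      funext i
      have hi := (mem_filter.mp hk).2 i
      dsimp only
      omega
    · intro k hk
      simp only [Finset.Nat.mem_antidiagonalTuple, Fin.sum_univ_three] at hk
      simp only [Nat.multinomial, Fin.sum_univ_three, Fin.prod_univ_three]
      congr 2
      omega

section RootOfUnity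

variable {R : Type*} [CommRing R] {w : R}

theorem sum_pow_cube_root (hw : w ^ 2 + w + 1 = 0) (k : ℕ) :
    ∑ j ∈ range 3, w ^ (j * (k + 1)) = if k % 3 = 2 then 3 else 0 := by
  have h3 : w ^ 3 = 1 := by linear_combination (w - 1) * hw
  obtain ⟨q, r, hr, rfl⟩ : ∃ q r, r < 3 ∧ k = 3 * q + r :=
    ⟨k / 3, k % 3, Nat.mod_lt _ (by norm_num), (Nat.div_add_mod k 3).symm⟩
  have hq (j : ℕ) : w ^ (j * (3 * q + r + 1)) = w ^ (j * (r + 1)) := by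
    rw [show j * (3 * q + r + 1) = 3 * (q * j) + j * (r + 1) by ring, pow_add, pow_mul, h3,
      one_pow, one_mul]
  simp only [hq, sum_range_succ, sum_range_zero]
  interval_cases r
  · rw [if_neg (by omega)]
    linear_combination hw
  · rw [if_neg (by omega)]
    linear_combination (w ^ 2 - w + 1) * hw
  · rw [if_pos (by omega)]
    linear_combination (w ^ 3 + 2) * h3

theorem twenty_seven_mul_CC_eq_sum (hw : w ^ 2 + w + 1 = 0) (n : ℕ) :
    27 * (CC n : R) = ∑ a ∈ range 3, ∑ b ∈ range 3, ∑ c ∈ range 3,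
      w ^ (a + b + c) * (w ^ a + w ^ b + w ^ c) ^ (3 * n) := by
  have expand (a b c : ℕ) : w ^ (a + b + c) * (w ^ a + w ^ b + w ^ c) ^ (3 * n) =
      ∑ k ∈ piAntidiag (univ : Finset (Fin 3)) (3 * n), (Nat.multinomial univ k : R) *
        (w ^ (a * (k 0 + 1)) * (w ^ (b * (k 1 + 1)) * w ^ (c * (k 2 + 1)))) := by
    have h := sum_pow_eq_sum_piAntidiag (univ : Finset (Fin 3)) ![w ^ a, w ^ b, w ^ c] (3 * n)
    simp only [Fin.sum_univ_three, Fin.prod_univ_three, Matrix.cons_val] at h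
    rw [h, mul_sum]
    refine sum_congr rfl fun k _ => ?_
    ring
  have factor (k : Fin 3 → ℕ) :
      ∑ a ∈ range 3, ∑ b ∈ range 3, ∑ c ∈ range 3, (Nat.multinomial univ k : R) *
        (w ^ (a * (k 0 + 1)) * (w ^ (b * (k 1 + 1)) * w ^ (c * (k 2 + 1)))) =
      if ∀ i, k i % 3 = 2 then 27 * (Nat.multinomial univ k : R) else 0 := by
    simp only [← mul_sum, ← sum_mul, sum_pow_cube_root hw, Fin.forall_fin_succ]
    by_cases h0 : k 0 % 3 = 2 <;> by_cases h1 : k 1 % 3 = 2 <;> by_cases h2 : k 2 % 3 = 2 <;>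
      simp [h0, h1, h2]
    ring
  simp only [expand]
  rw [CC_eq_sum_multinomial, Nat.cast_sum, mul_sum, sum_filter]
  simp only [← factor]
  rw [sum_comm]
  refine sum_congr rfl fun a _ => ?_
  rw [sum_comm]
  refine sum_congr rfl fun b _ => ?_
  rw [sum_comm]

theorem pow_mul_sum_pow_cube_root (hw : w ^ 2 + w + 1 = 0) {n : ℕ} (hn : 1 ≤ n) {a b c : ℕ}
    (ha : a < 3) (hb : b < 3) (hc : c < 3) :
    w ^ (a + b + c) * (w ^ a + w ^ b + w ^ c) ^ (3 * n) =
      if (a + b + c) % 3 = 0 then (if a = b then 27 ^ n else 0)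
      else if (a + b + c) % 3 = 1 then w * (3 + 6 * w) ^ n
      else w ^ 2 * (-(3 + 6 * w)) ^ n := by
  have hz : (0 : R) ^ n = 0 := zero_pow (by omega)
  have pow_congr {x y s t : R} (hs : s = t) (hx : x ^ 3 = y) : s * x ^ (3 * n) = t * y ^ n := by
    rw [hs, pow_mul, hx]
  interval_cases a <;> interval_cases b <;> interval_cases c <;>
    norm_num only [if_true, if_false] <;>
    first
    | exact pow_congr (by grind) (by grind)
    | exact (pow_congr (t := 1) (y := 27) (by grind) (by grind)).trans (one_mul _)
    | exact (pow_congr (t := 1) (y := 0) (by grind) (by grind)).trans (by rw [hz, mul_zero])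

theorem CC_root_of_unity_formula (hw : w ^ 2 + w + 1 = 0) {n : ℕ} (hn : 1 ≤ n) :
    27 * (CC n : R) =
      3 * 27 ^ n + 9 * (w * (3 + 6 * w) ^ n + w ^ 2 * (-(3 + 6 * w)) ^ n) := by
  rw [twenty_seven_mul_CC_eq_sum hw, sum_congr rfl fun a ha => sum_congr rfl fun b hb => sum_congr rfl
    fun c hc => pow_mul_sum_pow_cube_root hw hn (mem_range.mp ha) (mem_range.mp hb)
      (mem_range.mp hc)]
  norm_num [sum_range_succ]
  ring

end RootOfUnity

theorem Complex.exists_sq_add_self_add_one_eq_zero : ∃ w : ℂ, w ^ 2 + w + 1 = 0 := by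
  have h := (Complex.isPrimitiveRoot_exp 3 (by norm_num)).geom_sum_eq_zero (by norm_num)
  simp only [sum_range_succ, sum_range_zero] at h
  exact ⟨_, by linear_combination h⟩

theorem CC_even {m : ℕ} (hm : 1 ≤ m) :
    (CC (2 * m) : ℤ) = 3 ^ (6 * m - 2) - (-1) ^ m * 3 ^ (3 * m - 1) := by
  obtain ⟨w, hw⟩ := Complex.exists_sq_add_self_add_one_eq_zero
  have h := CC_root_of_unity_formula hw (n := 2 * m) (by omega)
  have hα : (3 + 6 * w) ^ 2 = -27 := by linear_combination 36 * hw
  rw [pow_mul (3 + 6 * w), pow_mul (-(3 + 6 * w)), neg_sq, hα] at h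
  have h' : 27 * (CC (2 * m) : ℂ) = 3 * 27 ^ (2 * m) - 9 * (-27) ^ m := by
    linear_combination h + 9 * (-27) ^ m * hw
  have hZ : 27 * (CC (2 * m) : ℤ) = 3 * 27 ^ (2 * m) - 9 * (-27) ^ m := by exact_mod_cast h'
  obtain ⟨k, rfl⟩ := Nat.exists_eq_add_of_le' hm
  rw [show 6 * (k + 1) - 2 = 6 * k + 4 by omega, show 3 * (k + 1) - 1 = 3 * k + 2 by omega]
  have h27 : (27 : ℤ) = 3 ^ 3 := by norm_num
  rw [neg_pow (27 : ℤ), h27, ← pow_mul, ← pow_mul] at hZ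
  ring_nf at hZ ⊢
  linarith

theorem CC_odd (m : ℕ) :
    (CC (2 * m + 1) : ℤ) = 3 ^ (6 * m + 1) + (-1) ^ (m + 1) * 3 ^ (3 * m + 1) := by
  obtain ⟨w, hw⟩ := Complex.exists_sq_add_self_add_one_eq_zero
  have h := CC_root_of_unity_formula hw (n := 2 * m + 1) (by omega)
  have hα : (3 + 6 * w) ^ 2 = -27 := by linear_combination 36 * hw
  rw [pow_succ (3 + 6 * w), pow_succ (-(3 + 6 * w)), pow_mul (3 + 6 * w),
    pow_mul (-(3 + 6 * w)), neg_sq, hα] at h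
  have h' : 27 * (CC (2 * m + 1) : ℂ) = 3 * 27 ^ (2 * m + 1) - 81 * (-27) ^ m := by
    linear_combination h + (-27) ^ m * (81 - 54 * w) * hw
  have hZ : 27 * (CC (2 * m + 1) : ℤ) = 3 * 27 ^ (2 * m + 1) - 81 * (-27) ^ m := by
    exact_mod_cast h'
  have h27 : (27 : ℤ) = 3 ^ 3 := by norm_num
  rw [neg_pow (27 : ℤ), h27, ← pow_mul, ← pow_mul] at hZ
  ring_nf at hZ ⊢
  linarith

theorem stmt_2 (n : ℕ) (hn : 1 ≤ n) :
    (CC n : ℂ) = 3 ^ (3 * n - 2) -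
      ((1 + (-1 : ℂ) ^ n) - Complex.I * Real.sqrt 3 * (1 - (-1 : ℂ) ^ n)) *
        (Complex.I ^ n / 2) * (3 : ℂ) ^ ((3 * (n : ℂ) - 2) / 2) ∧
    (Even n →
      (CC n : ℤ) = 3 ^ (3 * n - 2) - (-1) ^ (n / 2) * 3 ^ ((3 * n - 2) / 2)) ∧
    (Odd n →
      (CC n : ℤ) = 3 ^ (3 * n - 2) + (-1) ^ ((n + 1) / 2) * 3 ^ ((3 * n - 1) / 2)) := by
  rcases Nat.even_or_odd' n with ⟨m, rfl | rfl⟩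
  · have h := CC_even (m := m) (by omega)
    have hC : (CC (2 * m) : ℂ) = 3 ^ (6 * m - 2) - (-1) ^ m * 3 ^ (3 * m - 1) := by
      exact_mod_cast congrArg (Int.cast : ℤ → ℂ) h
    refine ⟨?_, fun _ => ?_, fun ho => ?_⟩
    · rw [hC, show 3 * (2 * m) - 2 = 6 * m - 2 by omega,
        show (3 * ((2 * m : ℕ) : ℂ) - 2) / 2 = ((3 * m - 1 : ℕ) : ℂ) by
          rw [Nat.cast_sub (by omega)]; push_cast; ring,
        Complex.cpow_natCast, pow_mul, pow_mul, Complex.I_sq]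
      norm_num
      ring
    · rw [h, show 3 * (2 * m) - 2 = 6 * m - 2 by omega, show 2 * m / 2 = m by omega,
        show (6 * m - 2) / 2 = 3 * m - 1 by omega]
    · rw [← Nat.not_even_iff_odd] at ho
      exact absurd (even_two_mul m) ho
  · have h := CC_odd m
    have hC : (CC (2 * m + 1) : ℂ) = 3 ^ (6 * m + 1) + (-1) ^ (m + 1) * 3 ^ (3 * m + 1) := by
      exact_mod_cast congrArg (Int.cast : ℤ → ℂ) h
    refine ⟨?_, fun he => ?_, fun _ => ?_⟩
    · have hs : (3 : ℂ) ^ (1 / 2 : ℂ) = (Real.sqrt 3 : ℂ) := by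
        rw [Real.sqrt_eq_rpow, Complex.ofReal_cpow (by norm_num)]
        norm_num
      have hs2 : (Real.sqrt 3 : ℂ) ^ 2 = 3 := by
        rw [← Complex.ofReal_pow, Real.sq_sqrt (by norm_num)]
        norm_num
      rw [hC, show 3 * (2 * m + 1) - 2 = 6 * m + 1 by omega,
        show (3 * ((2 * m + 1 : ℕ) : ℂ) - 2) / 2 = ((3 * m : ℕ) : ℂ) + 1 / 2 by
          push_cast; ring,
        Complex.cpow_add _ _ (by norm_num), Complex.cpow_natCast, hs, pow_succ (-1 : ℂ) (2 * m),
        pow_succ Complex.I, pow_mul (-1 : ℂ) 2, pow_mul Complex.I, Complex.I_sq]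
      norm_num
      linear_combination (-(-1) ^ m * 3 ^ (3 * m) * (Real.sqrt 3 : ℂ) ^ 2) * Complex.I_sq +
        (-1) ^ m * 3 ^ (3 * m) * hs2
    · rw [← Nat.not_odd_iff_even] at he
      exact absurd (odd_two_mul_add_one m) he
    · rw [h, show 3 * (2 * m + 1) - 2 = 6 * m + 1 by omega,
        show (2 * m + 1 + 1) / 2 = m + 1 by omega,
        show (3 * (2 * m + 1) - 1) / 2 = 3 * m + 1 by omega]
end

section
/- For every natural number n ≥ 1, C_D(n) = 2·3^(3n−1). -/
open Nat Finset

/-- `CD n` is the number of words of length `3n` over a three-letter alphabet in which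
the three letters occur numbers of times congruent to 0, 1, 2 mod 3 in some order:
`6` times the sum over triples `k1 + k2 + k3 = n - 1` of
`(3n)! / ((3k1)! (3k2+1)! (3k3+2)!)`, with `CD 0 = 0`. -/
def CD (n : ℕ) : ℕ :=
  if n = 0 then 0 else
    6 * ∑ k ∈ Finset.Nat.antidiagonalTuple 3 (n - 1),
      (3 * n)! / ((3 * k 0)! * (3 * k 1 + 1)! * (3 * k 2 + 2)!)

/-- The sum of `g a b c` over all words of length `m` in three letters, where `a`, `b`, `c` are
the numbers of occurrences of the letters. -/
def wordSum (g : ℕ → ℕ → ℕ → ℕ) (m : ℕ) : ℕ :=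
  ∑ p ∈ antidiagonal m, m.choose p.1 *
    ∑ q ∈ antidiagonal p.2, p.2.choose q.1 * g p.1 q.1 q.2

lemma wordSum_zero (g : ℕ → ℕ → ℕ → ℕ) : wordSum g 0 = g 0 0 0 := by
  simp [wordSum]

lemma sum_antidiagonal_choose_mul_succ (f : ℕ → ℕ → ℕ) (m : ℕ) :
    ∑ p ∈ antidiagonal (m + 1), (m + 1).choose p.1 * f p.1 p.2 =
      ∑ p ∈ antidiagonal m, m.choose p.1 * f p.1 (p.2 + 1) +
        ∑ p ∈ antidiagonal m, m.choose p.1 * f (p.1 + 1) p.2 := by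
  have h := Finset.sum_antidiagonal_choose_succ_mul f m
  simp only [Nat.cast_id] at h
  rw [h]
  congr 1
  refine Finset.sum_congr rfl fun p hp => ?_
  rw [Nat.choose_symm_of_eq_add (HasAntidiagonal.mem_antidiagonal.mp hp).symm]

lemma wordSum_add (g h : ℕ → ℕ → ℕ → ℕ) (m : ℕ) :
    wordSum (fun a b c => g a b c + h a b c) m = wordSum g m + wordSum h m := by
  simp only [wordSum, mul_add, Finset.sum_add_distrib]

lemma wordSum_succ (g : ℕ → ℕ → ℕ → ℕ) (m : ℕ) :
    wordSum g (m + 1) =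
      wordSum (fun a b c => g (a + 1) b c + g a (b + 1) c + g a b (c + 1)) m := by
  rw [wordSum_add, wordSum_add]
  unfold wordSum
  rw [sum_antidiagonal_choose_mul_succ
    (fun a s => ∑ q ∈ antidiagonal s, s.choose q.1 * g a q.1 q.2)]
  simp only [fun a s => sum_antidiagonal_choose_mul_succ (g a) s, mul_add,
    Finset.sum_add_distrib]
  ring

lemma wordSum_swap_left (g : ℕ → ℕ → ℕ → ℕ) (m : ℕ) :
    wordSum (fun a b c => g b a c) m = wordSum g m := by
  induction m generalizing g with
  | zero => simp [wordSum_zero]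
  | succ m ih =>
    rw [wordSum_succ, wordSum_succ, ← ih]
    congr 1
    funext a b c
    ring

lemma wordSum_swap_right (g : ℕ → ℕ → ℕ → ℕ) (m : ℕ) :
    wordSum (fun a b c => g a c b) m = wordSum g m := by
  induction m generalizing g with
  | zero => simp [wordSum_zero]
  | succ m ih =>
    rw [wordSum_succ, wordSum_succ, ← ih]
    congr 1
    funext a b c
    ring

lemma wordSum_const (k m : ℕ) : wordSum (fun _ _ _ => k) m = k * 3 ^ m := by
  induction m generalizing k with
  | zero => simp [wordSum_zero]
  | succ m ih => rw [wordSum_succ, ih]; ring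

lemma wordSum_congr {g h : ℕ → ℕ → ℕ → ℕ} {m : ℕ}
    (hgh : ∀ a b c, a + b + c = m → g a b c = h a b c) : wordSum g m = wordSum h m := by
  refine Finset.sum_congr rfl fun p hp => ?_
  congr 1
  refine Finset.sum_congr rfl fun q hq => ?_
  rw [HasAntidiagonal.mem_antidiagonal] at hp hq
  rw [hgh _ _ _ (by omega)]

/-- The indicator function of triples congruent to `(0, 1, 2)` modulo `3`. -/
def residueIndicator (a b c : ℕ) : ℕ :=
  if a % 3 = 0 ∧ b % 3 = 1 ∧ c % 3 = 2 then 1 else 0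

/-- The indicator function of triples congruent to a permutation of `(0, 1, 2)` modulo `3`. -/
def permResidueIndicator (a b c : ℕ) : ℕ :=
  residueIndicator a b c + residueIndicator b a c + residueIndicator a c b +
    residueIndicator c a b + residueIndicator b c a + residueIndicator c b a

lemma wordSum_permResidueIndicator (m : ℕ) :
    wordSum permResidueIndicator m = 6 * wordSum residueIndicator m := by
  let g := residueIndicator
  have h1 : wordSum (fun a b c => g b a c) m = wordSum g m := wordSum_swap_left g m
  have h2 : wordSum (fun a b c => g a c b) m = wordSum g m := wordSum_swap_right g m
  have h3 : wordSum (fun a b c => g c a b) m = wordSum g m :=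
    (wordSum_swap_right (fun a b c => g b a c) m).trans h1
  have h4 : wordSum (fun a b c => g b c a) m = wordSum g m :=
    (wordSum_swap_left (fun a b c => g a c b) m).trans h2
  have h5 : wordSum (fun a b c => g c b a) m = wordSum g m :=
    (wordSum_swap_left (fun a b c => g c a b) m).trans h3
  change wordSum (fun a b c => g a b c + g b a c + g a c b + g c a b + g b c a + g c b a) m =
    6 * wordSum g m
  simp only [wordSum_add, h1, h2, h3, h4, h5]
  ring

/-- Of the three ways to append a letter to a word of length `2` modulo `3`, exactly two lead
to letter counts congruent to a permutation of `(0, 1, 2)`. -/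
lemma permResidueIndicator_shift (a b c : ℕ) (h : (a + b + c) % 3 = 2) :
    permResidueIndicator (a + 1) b c + permResidueIndicator a (b + 1) c +
      permResidueIndicator a b (c + 1) = 2 := by
  have ha : a % 3 < 3 := Nat.mod_lt _ (by norm_num)
  have hb : b % 3 < 3 := Nat.mod_lt _ (by norm_num)
  have hc : c % 3 < 3 := Nat.mod_lt _ (by norm_num)
  simp only [permResidueIndicator, residueIndicator, Nat.add_mod a 1, Nat.add_mod b 1,
    Nat.add_mod c 1]
  rw [Nat.add_mod, Nat.add_mod a] at h
  generalize a % 3 = x at *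
  generalize b % 3 = y at *
  generalize c % 3 = z at *
  interval_cases x <;> interval_cases y <;> interval_cases z <;> simp_all

lemma factorial_div_eq_choose_mul_choose (a b c : ℕ) :
    (a + (b + c))! / (a ! * b ! * c !) = (a + (b + c)).choose a * (b + c).choose b := by
  refine Nat.div_eq_of_eq_mul_left (by positivity) ?_
  rw [Nat.choose_symm_add, Nat.choose_symm_add (a := b),
    ← Nat.add_choose_mul_factorial_mul_factorial a (b + c),
    ← Nat.add_choose_mul_factorial_mul_factorial b c]
  ring

lemma sum_antidiagonalTuple_eq_wordSum (m : ℕ) :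
    ∑ k ∈ Finset.Nat.antidiagonalTuple 3 m,
      (3 * (m + 1))! / ((3 * k 0)! * (3 * k 1 + 1)! * (3 * k 2 + 2)!) =
        wordSum residueIndicator (3 * (m + 1)) := by
  unfold wordSum
  simp only [Finset.mul_sum]
  rw [Finset.sum_sigma']
  refine Finset.sum_of_injOn
    (fun k => ⟨(3 * k 0, (3 * k 1 + 1) + (3 * k 2 + 2)), (3 * k 1 + 1, 3 * k 2 + 2)⟩)
    ?_ ?_ ?_ ?_
  · intro k _ l _ h
    simp only [Sigma.mk.injEq, Prod.mk.injEq, heq_eq_eq] at h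
    funext i
    fin_cases i <;> simp <;> omega
  · intro k hk
    simp only [mem_coe, Finset.Nat.mem_antidiagonalTuple, Fin.sum_univ_three] at hk
    simp only [mem_coe, mem_sigma, HasAntidiagonal.mem_antidiagonal, and_true]
    omega
  · rintro ⟨⟨a, s⟩, ⟨b, c⟩⟩ h hn
    simp only [mem_sigma, HasAntidiagonal.mem_antidiagonal] at h
    obtain ⟨hs, rfl⟩ := h
    suffices ¬(a % 3 = 0 ∧ b % 3 = 1 ∧ c % 3 = 2) by simp [residueIndicator, this]
    rintro ⟨ha, hb, hc⟩
    refine hn ⟨![a / 3, b / 3, c / 3], ?_, ?_⟩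
    · simp only [mem_coe, Finset.Nat.mem_antidiagonalTuple, Fin.sum_univ_three]
      simp
      omega
    · have ha' : 3 * (a / 3) = a := by omega
      have hb' : 3 * (b / 3) + 1 = b := by omega
      have hc' : 3 * (c / 3) + 2 = c := by omega
      simp [ha', hb', hc']
  · intro k hk
    simp only [Finset.Nat.mem_antidiagonalTuple, Fin.sum_univ_three] at hk
    have hm : 3 * (m + 1) = 3 * k 0 + ((3 * k 1 + 1) + (3 * k 2 + 2)) := by omega
    have hr : residueIndicator (3 * k 0) (3 * k 1 + 1) (3 * k 2 + 2) = 1 :=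
      if_pos (by omega)
    simp only [hm, factorial_div_eq_choose_mul_choose, hr, mul_one]

theorem stmt_3 (n : ℕ) (hn : 1 ≤ n) : CD n = 2 * 3 ^ (3 * n - 1) := by
  obtain ⟨m, rfl⟩ := Nat.exists_eq_add_of_le' hn
  rw [CD, if_neg (by omega), Nat.add_sub_cancel, sum_antidiagonalTuple_eq_wordSum,
    ← wordSum_permResidueIndicator, show 3 * (m + 1) = 3 * m + 2 + 1 by ring, wordSum_succ,
    Nat.add_sub_cancel, ← wordSum_const]
  exact wordSum_congr fun a b c h => permResidueIndicator_shift a b c (by omega)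
end

section
/- For every real number x with |x| < 1/27, the power series Σ_{n=0}^∞ C_B(n)·x^n converges and equals 6x·(27x² + 12x − 1) / ((27x − 1)·(27x² + 1)). -/
open Nat Finset

/-- `CB n` is the number of words of length `3n` over a three-letter alphabet in which
each letter occurs a number of times congruent to 1 mod 3:
the sum over triples `k1 + k2 + k3 = n - 1` of `(3n)! / ((3k1+1)! (3k2+1)! (3k3+1)!)`,
with `CB 0 = 0`. -/
def CB (n : ℕ) : ℕ :=
  if n = 0 then 0 else
    ∑ k ∈ Finset.Nat.antidiagonalTuple 3 (n - 1),
      (3 * n)! / ((3 * k 0 + 1)! * (3 * k 1 + 1)! * (3 * k 2 + 1)!)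

theorem CB_eq_sum_multinomial (n : ℕ) :
    CB n = ∑ k ∈ piAntidiag (univ : Finset (Fin 3)) (3 * n) with k 1 % 3 = 1 ∧ k 2 % 3 = 1,
      Nat.multinomial univ k := by
  unfold CB
  split_ifs with hn
  · subst hn
    symm
    apply Finset.sum_eq_zero
    intro k hk
    simp only [mem_filter, mem_piAntidiag, Fin.sum_univ_three] at hk
    omega
  · refine Finset.sum_nbij' (fun k i => 3 * k i + 1) (fun k i => k i / 3) ?_ ?_ ?_ ?_ ?_
    · intro k hk
      simp only [Finset.Nat.mem_antidiagonalTuple, Fin.sum_univ_three] at hk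
      simp only [mem_filter, mem_piAntidiag, Fin.sum_univ_three]
      refine ⟨⟨by omega, by simp⟩, by omega, by omega⟩
    · intro k hk
      simp only [mem_filter, mem_piAntidiag, Fin.sum_univ_three] at hk
      simp only [Finset.Nat.mem_antidiagonalTuple, Fin.sum_univ_three]
      omega
    · intro k _
      funext i
      simp only
      omega
    · intro k hk
      simp only [mem_filter, mem_piAntidiag, Fin.sum_univ_three] at hk
      funext i
      fin_cases i <;> simp <;> omega
    · intro k hk
      simp only [Finset.Nat.mem_antidiagonalTuple, Fin.sum_univ_three] at hk
      simp only [Nat.multinomial, Fin.sum_univ_three, Fin.prod_univ_three]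
      congr 2
      omega

theorem sum_range_three_root_of_unity_filter {ω : ℂ} (hω : ω ^ 2 + ω + 1 = 0) (a : ℕ) :
    ∑ i ∈ range 3, ω ^ (2 * i) * (ω ^ i) ^ a = if a % 3 = 1 then 3 else 0 := by
  have h3 : ω ^ 3 = 1 := by linear_combination (ω - 1) * hω
  have key : ∀ i, (ω ^ i) ^ a = (ω ^ i) ^ (a % 3) := by
    intro i
    conv_lhs => rw [← Nat.div_add_mod a 3]
    rw [pow_add, pow_mul, ← pow_mul ω i 3, mul_comm i 3, pow_mul ω 3, h3, one_pow, one_pow,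
      one_mul]
  simp only [key]
  have hlt : a % 3 < 3 := Nat.mod_lt _ (by norm_num)
  interval_cases a % 3
  · simp only [sum_range_succ, sum_range_zero]
    norm_num
    linear_combination (ω ^ 2 - ω + 1) * hω
  · simp only [sum_range_succ, sum_range_zero]
    norm_num
    linear_combination (ω ^ 3 + 2) * h3
  · simp only [sum_range_succ, sum_range_zero]
    norm_num
    linear_combination hω + (ω + ω ^ 2 * (ω ^ 3 + 1)) * h3

theorem nine_mul_CB_eq_sum {ω : ℂ} (hω : ω ^ 2 + ω + 1 = 0) (n : ℕ) :
    9 * (CB n : ℂ) = ∑ i ∈ range 3, ∑ j ∈ range 3,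
      ω ^ (2 * i) * ω ^ (2 * j) * (1 + ω ^ i + ω ^ j) ^ (3 * n) := by
  have expand : ∀ i j, (1 + ω ^ i + ω ^ j) ^ (3 * n) =
      ∑ k ∈ piAntidiag (univ : Finset (Fin 3)) (3 * n),
        (Nat.multinomial univ k : ℂ) * ((ω ^ i) ^ k 1 * (ω ^ j) ^ k 2) := by
    intro i j
    have h := Finset.sum_pow_eq_sum_piAntidiag (univ : Finset (Fin 3)) ![1, ω ^ i, ω ^ j] (3 * n)
    simpa [Fin.sum_univ_three, Fin.prod_univ_three] using h
  have collect : ∀ k : Fin 3 → ℕ, ∑ i ∈ range 3, ∑ j ∈ range 3,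
      ω ^ (2 * i) * ω ^ (2 * j) *
        ((Nat.multinomial univ k : ℂ) * ((ω ^ i) ^ k 1 * (ω ^ j) ^ k 2)) =
      if k 1 % 3 = 1 ∧ k 2 % 3 = 1 then 9 * (Nat.multinomial univ k : ℂ) else 0 := by
    intro k
    calc _ = (Nat.multinomial univ k : ℂ) * ((∑ i ∈ range 3, ω ^ (2 * i) * (ω ^ i) ^ k 1) *
          ∑ j ∈ range 3, ω ^ (2 * j) * (ω ^ j) ^ k 2) := by
          rw [Finset.sum_mul_sum, Finset.mul_sum]
          refine sum_congr rfl fun i _ => ?_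
          rw [Finset.mul_sum]
          exact sum_congr rfl fun j _ => by ring
      _ = _ := by
          rw [sum_range_three_root_of_unity_filter hω, sum_range_three_root_of_unity_filter hω]
          by_cases h1 : k 1 % 3 = 1 <;> by_cases h2 : k 2 % 3 = 1 <;> (simp [h1, h2]; try ring)
  simp only [expand, Finset.mul_sum]
  rw [CB_eq_sum_multinomial, Nat.cast_sum, Finset.mul_sum, Finset.sum_filter]
  simp only [← collect]
  rw [Finset.sum_comm]
  refine sum_congr rfl fun i _ => ?_
  rw [Finset.sum_comm]

theorem nine_mul_CB {ω : ℂ} (hω : ω ^ 2 + ω + 1 = 0) (n : ℕ) :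
    9 * (CB n : ℂ) = 27 ^ n + 3 * ω ^ 2 * (3 + 6 * ω) ^ n + 3 * ω * (-(3 + 6 * ω)) ^ n +
      2 * 0 ^ n := by
  have h3 : ω ^ 3 = 1 := by linear_combination (ω - 1) * hω
  have h4 : ω ^ 4 = ω := by linear_combination ω * h3
  have h01 : (2 + ω) ^ 3 = 3 + 6 * ω := by linear_combination h3 + 6 * hω
  have h02 : (1 - ω) ^ 3 = -(3 + 6 * ω) := by linear_combination -h3 + 3 * hω
  have h11 : (1 + 2 * ω) ^ 3 = -(3 + 6 * ω) := by linear_combination 8 * h3 + 12 * hω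
  have h22 : (-1 - 2 * ω) ^ 3 = 3 + 6 * ω := by linear_combination -8 * h3 - 12 * hω
  rw [nine_mul_CB_eq_sum hω]
  simp only [sum_range_succ, sum_range_zero, pow_mul]
  have e1 : 1 + ω ^ 0 + ω ^ 1 = 2 + ω := by ring
  have e2 : 1 + ω ^ 1 + ω ^ 0 = 2 + ω := by ring
  have e3 : 1 + ω ^ 0 + ω ^ 2 = 1 - ω := by linear_combination hω
  have e4 : 1 + ω ^ 2 + ω ^ 0 = 1 - ω := by linear_combination hω
  have e5 : 1 + ω ^ 1 + ω ^ 1 = 1 + 2 * ω := by ring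
  have e6 : 1 + ω ^ 2 + ω ^ 2 = -1 - 2 * ω := by linear_combination 2 * hω
  have e7 : 1 + ω ^ 1 + ω ^ 2 = 0 := by linear_combination hω
  have e8 : 1 + ω ^ 2 + ω ^ 1 = 0 := by linear_combination hω
  have e0 : (1 + ω ^ 0 + ω ^ 0) ^ 3 = 27 := by norm_num
  rw [e0, e1, e2, e3, e4, e5, e6, e7, e8, h01, h02, h11, h22]
  have hz : (0 : ℂ) ^ 3 = 0 := by norm_num
  rw [hz]
  have h8 : ω ^ 8 = ω ^ 2 := by linear_combination (ω ^ 5 + ω ^ 2) * h3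
  have h6 : ω ^ 6 = 1 := by linear_combination (ω ^ 3 + 1) * h3
  ring_nf
  simp only [h8, h6, h4]
  ring

theorem stmt_6 (x : ℝ) (hx : |x| < 1 / 27) :
    HasSum (fun n : ℕ => (CB n : ℝ) * x ^ n)
      (6 * x * (27 * x ^ 2 + 12 * x - 1) / ((27 * x - 1) * (27 * x ^ 2 + 1))) := by
  obtain ⟨ω, hω⟩ : ∃ ω : ℂ, ω ^ 2 + ω + 1 = 0 := by
    have h := (Complex.isPrimitiveRoot_exp 3 (by norm_num)).geom_sum_eq_zero (by norm_num)
    simp only [sum_range_succ, sum_range_zero] at h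
    exact ⟨_, by linear_combination h⟩
  set θ : ℂ := 3 + 6 * ω with hθ
  have hθsq : θ ^ 2 = -27 := by rw [hθ]; linear_combination 36 * hω
  have hθnorm : ‖θ‖ ≤ 27 := by
    have h : ‖θ‖ ^ 2 = 27 := by rw [← norm_pow, hθsq]; norm_num
    nlinarith [norm_nonneg θ]
  have small : ∀ z : ℂ, ‖z‖ ≤ 27 → ‖z * (x : ℂ)‖ < 1 := by
    intro z hz
    rw [norm_mul, Complex.norm_real, Real.norm_eq_abs]
    nlinarith [abs_nonneg x]
  have geom : ∀ z : ℂ, ‖z‖ ≤ 27 → HasSum (fun n : ℕ => (z * x) ^ n) (1 - z * x)⁻¹ :=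
    fun z hz => hasSum_geometric_of_norm_lt_one (small z hz)
  have ne : ∀ z : ℂ, ‖z‖ ≤ 27 → 1 - z * x ≠ 0 := by
    intro z hz h
    have h' := small z hz
    rw [← sub_eq_zero.mp h, norm_one] at h'
    exact lt_irrefl _ h'
  have n27 : ‖(27 : ℂ)‖ ≤ 27 := by norm_num
  have nneg : ‖-θ‖ ≤ 27 := by rwa [norm_neg]
  have total := (((geom 27 n27).add ((geom θ hθnorm).mul_left (3 * ω ^ 2))).add
    ((geom (-θ) nneg).mul_left (3 * ω))).add ((geom 0 (by simp)).mul_left 2) |>.mul_left (1 / 9)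
  rw [← Complex.hasSum_ofReal]
  have terms : (fun n : ℕ => (((CB n : ℝ) * x ^ n : ℝ) : ℂ)) = fun n =>
      1 / 9 * ((27 * (x : ℂ)) ^ n + 3 * ω ^ 2 * (θ * x) ^ n + 3 * ω * (-θ * x) ^ n +
        2 * (0 * (x : ℂ)) ^ n) := by
    funext n
    have h := nine_mul_CB hω n
    rw [← hθ] at h
    push_cast
    simp only [mul_pow]
    linear_combination (1 / 9 * (x : ℂ) ^ n) * h
  have h1 := ne 27 n27
  have h2 := ne θ hθnorm
  have h3 := ne (-θ) nneg
  have hfac : (1 - θ * x) * (1 - -θ * x) = 27 * (x : ℂ) ^ 2 + 1 := by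
    linear_combination -(x : ℂ) ^ 2 * hθsq
  have h4 : 27 * (x : ℂ) ^ 2 + 1 ≠ 0 := hfac ▸ mul_ne_zero h2 h3
  have h5 : 27 * (x : ℂ) - 1 ≠ 0 := by
    intro h
    exact h1 (by linear_combination -h)
  have combine : 3 * ω ^ 2 * (1 - θ * x)⁻¹ + 3 * ω * (1 - -θ * x)⁻¹ =
      (27 * x - 3) / (27 * (x : ℂ) ^ 2 + 1) := by
    have hinv : (1 - θ * x)⁻¹ = (1 - -θ * x) / (27 * (x : ℂ) ^ 2 + 1) := by
      rw [← hfac, div_mul_cancel_right₀ h3]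
    have hinv' : (1 - -θ * x)⁻¹ = (1 - θ * x) / (27 * (x : ℂ) ^ 2 + 1) := by
      rw [← hfac, div_mul_cancel_left₀ h2]
    rw [hinv, hinv', ← mul_div_assoc, ← mul_div_assoc, ← add_div, hθ]
    congr 1
    linear_combination (3 + 3 * x * (6 * ω - 9)) * hω
  have combine27 : (1 - 27 * (x : ℂ))⁻¹ = -1 / (27 * x - 1) := by
    rw [← neg_sub (27 * (x : ℂ)) 1, inv_neg, neg_div, one_div]
  have value : ((6 * x * (27 * x ^ 2 + 12 * x - 1) / ((27 * x - 1) * (27 * x ^ 2 + 1)) : ℝ) : ℂ) =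
      1 / 9 * ((1 - 27 * (x : ℂ))⁻¹ + 3 * ω ^ 2 * (1 - θ * x)⁻¹ + 3 * ω * (1 - -θ * x)⁻¹ +
        2 * (1 - 0 * (x : ℂ))⁻¹) := by
    rw [combine27, add_assoc (-1 / (27 * (x : ℂ) - 1)), combine, zero_mul, sub_zero, inv_one]
    push_cast
    rw [div_add_div _ _ h5 h4, div_add' _ _ _ (mul_ne_zero h5 h4), ← mul_div_assoc]
    congr 1
    ring
  rw [terms, value]
  exact total
end

section
/- For every real number x with |x| < 1/27, the power series Σ_{n=0}^∞ C_C(n)·x^n converges and equals 18x²·(5 − 9x) / ((1 − 27x)·(1 + 27x²)). -/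
open Nat Finset

open PowerSeries in
theorem coeff_pow_eq_sum_antidiagonalTuple {R : Type*} [CommSemiring R] (g : PowerSeries R)
    (k n : ℕ) :
    coeff n (g ^ k) = ∑ l ∈ Finset.Nat.antidiagonalTuple k n, ∏ i, coeff (l i) g := by
  have h : g ^ k = ∏ _i : Fin k, g := by simp
  rw [h, coeff_prod]
  refine Finset.sum_nbij' (fun l => ⇑l) (fun l => Finsupp.equivFunOnFinite.symm l) ?_ ?_ ?_ ?_ ?_
  · intro l hl
    simpa [Finset.Nat.mem_antidiagonalTuple, Finset.mem_finsuppAntidiag] using hl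
  · intro l hl
    simpa [Finset.Nat.mem_antidiagonalTuple, Finset.mem_finsuppAntidiag] using hl
  · intro l _
    ext i
    simp
  · intro l _
    rfl
  · intro l _
    rfl

open PowerSeries in
/-- The coefficients of the cube of a combination of three exponentials `e ^ (a X)`. -/
theorem coeff_cube_add_exp (u v a b c : ℂ) (m : ℕ) :
    coeff m ((rescale a (exp ℂ) + C u * rescale b (exp ℂ) + C v * rescale c (exp ℂ)) ^ 3) =
      ((a + a + a) ^ m + u ^ 3 * (b + b + b) ^ m + v ^ 3 * (c + c + c) ^ m
        + 3 * u * (a + a + b) ^ m + 3 * v * (a + a + c) ^ m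
        + 3 * u ^ 2 * (a + b + b) ^ m + 3 * v ^ 2 * (a + c + c) ^ m
        + 3 * u ^ 2 * v * (b + b + c) ^ m + 3 * u * v ^ 2 * (b + c + c) ^ m
        + 6 * u * v * (a + b + c) ^ m) / (m ! : ℂ) := by
  have key : (rescale a (exp ℂ) + C u * rescale b (exp ℂ) + C v * rescale c (exp ℂ)) ^ 3 =
      rescale (a + a + a) (exp ℂ) + C (u ^ 3) * rescale (b + b + b) (exp ℂ)
        + C (v ^ 3) * rescale (c + c + c) (exp ℂ)
        + C (3 * u) * rescale (a + a + b) (exp ℂ) + C (3 * v) * rescale (a + a + c) (exp ℂ)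
        + C (3 * u ^ 2) * rescale (a + b + b) (exp ℂ)
        + C (3 * v ^ 2) * rescale (a + c + c) (exp ℂ)
        + C (3 * u ^ 2 * v) * rescale (b + b + c) (exp ℂ)
        + C (3 * u * v ^ 2) * rescale (b + c + c) (exp ℂ)
        + C (6 * u * v) * rescale (a + b + c) (exp ℂ) := by
    simp only [← exp_mul_exp_eq_exp_add, map_mul, map_pow, map_ofNat]
    ring
  rw [key]
  simp only [map_add, coeff_C_mul, coeff_rescale, coeff_exp]
  simp only [one_div, map_inv₀, map_natCast]
  ring

/-- The series `∑ X ^ k / (3 k + 2)!`. -/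
noncomputable def factorialSection : PowerSeries ℂ :=
  PowerSeries.mk fun k => ((3 * k + 2)! : ℂ)⁻¹

open PowerSeries in
theorem rescale_exp_filter {w : ℂ} (hw : w ^ 2 + w + 1 = 0) :
    rescale 1 (exp ℂ) + C w * rescale w (exp ℂ) + C (w ^ 2) * rescale (w ^ 2) (exp ℂ) =
      C 3 * (X ^ 2 * expand 3 three_ne_zero factorialSection) := by
  have h3 : w ^ 3 = 1 := by linear_combination (w - 1) * hw
  ext m
  simp only [map_add, coeff_C_mul, coeff_rescale, coeff_exp, coeff_X_pow_mul', coeff_expand,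
    factorialSection, coeff_mk, one_div, map_inv₀, map_natCast]
  obtain ⟨q, rfl | rfl | rfl⟩ : ∃ q, m = 3 * q ∨ m = 3 * q + 1 ∨ m = 3 * q + 2 :=
    ⟨m / 3, by omega⟩
  · have hp : w ^ (3 * q) = 1 := by rw [pow_mul, h3, one_pow]
    have : ¬ (2 ≤ 3 * q ∧ 3 ∣ 3 * q - 2) := by omega
    rw [← ite_and, if_neg this, pow_right_comm, hp]
    linear_combination (((3 * q)! : ℂ)⁻¹) * hw
  · have hp : w ^ (3 * q + 1) = w := by rw [pow_succ, pow_mul, h3, one_pow, one_mul]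
    have : ¬ (2 ≤ 3 * q + 1 ∧ 3 ∣ 3 * q + 1 - 2) := by omega
    rw [← ite_and, if_neg this, pow_right_comm, hp]
    linear_combination (((3 * q + 1)! : ℂ)⁻¹) * (hw + w * h3)
  · have hp : w ^ (3 * q + 2) = w ^ 2 := by rw [pow_add, pow_mul, h3, one_pow, one_mul]
    have : 2 ≤ 3 * q + 2 ∧ 3 ∣ 3 * q + 2 - 2 := by omega
    rw [← ite_and, if_pos this, pow_right_comm, hp,
      show (3 * q + 2 - 2) / 3 = q by omega]
    linear_combination (((3 * q + 2)! : ℂ)⁻¹) * (w ^ 3 + 2) * h3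

theorem cast_factorial_div_three {N a b c : ℕ} (h : a + b + c = N) :
    ((N ! / (a ! * b ! * c !) : ℕ) : ℂ) = N ! * ((a ! : ℂ)⁻¹ * (b ! : ℂ)⁻¹ * (c ! : ℂ)⁻¹) := by
  have hd : a ! * b ! * c ! ∣ N ! := by
    rw [← h]
    exact (mul_dvd_mul_right (Nat.factorial_mul_factorial_dvd_factorial_add a b) _).trans
      (Nat.factorial_mul_factorial_dvd_factorial_add _ _)
  rw [Nat.cast_div hd (by simp [Nat.factorial_ne_zero])]
  push_cast
  rw [div_eq_mul_inv, mul_inv, mul_inv]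

open PowerSeries in
theorem CC_eq_coeff (n : ℕ) :
    (CC n : ℂ) =
      (3 * n)! * coeff (3 * n) ((X ^ 2 * expand 3 three_ne_zero factorialSection) ^ 3) := by
  rw [mul_pow, ← pow_mul, ← map_pow, coeff_X_pow_mul', CC]
  by_cases hn : n ≤ 1
  · rw [if_pos hn, if_neg (by omega)]
    simp
  · rw [if_neg hn, if_pos (by omega), show 3 * n - 2 * 3 = 3 * (n - 2) by omega,
      coeff_expand_mul, coeff_pow_eq_sum_antidiagonalTuple, Nat.cast_sum, Finset.mul_sum]
    refine Finset.sum_congr rfl fun k hk => ?_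
    rw [Finset.Nat.mem_antidiagonalTuple, Fin.sum_univ_three] at hk
    rw [cast_factorial_div_three (by omega), Fin.prod_univ_three]
    simp only [factorialSection, coeff_mk]

theorem CC_eq {w : ℂ} (hw : w ^ 2 + w + 1 = 0) (n : ℕ) :
    (CC n : ℂ) =
      (27 ^ n + 3 * (w * (3 + 6 * w) ^ n + w ^ 2 * (-(3 + 6 * w)) ^ n) + 2 * 0 ^ n) / 9 := by
  have h3 : w ^ 3 = 1 := by linear_combination (w - 1) * hw
  have hf : ((3 * n)! : ℂ) ≠ 0 := Nat.cast_ne_zero.mpr (Nat.factorial_ne_zero _)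
  have hc := coeff_cube_add_exp w (w ^ 2) 1 w (w ^ 2) (3 * n)
  rw [rescale_exp_filter hw, mul_pow, ← map_pow, PowerSeries.coeff_C_mul] at hc
  have e1 : (1 + 1 + 1 : ℂ) ^ 3 = 27 := by norm_num
  have e2 : (w + w + w) ^ 3 = 27 := by linear_combination 27 * h3
  have e3 : (w ^ 2 + w ^ 2 + w ^ 2) ^ 3 = 27 := by linear_combination 27 * (w ^ 3 + 1) * h3
  have e4 : (1 + 1 + w) ^ 3 = 3 + 6 * w := by linear_combination (w + 5) * hw
  have hw2 : w ^ 2 = -1 - w := by linear_combination hw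
  have e5 : (1 + 1 + w ^ 2) ^ 3 = -(3 + 6 * w) := by
    rw [hw2]; linear_combination (-w + 4) * hw
  have e6 : (1 + w + w) ^ 3 = -(3 + 6 * w) := by linear_combination (8 * w + 4) * hw
  have e7 : (1 + w ^ 2 + w ^ 2) ^ 3 = 3 + 6 * w := by
    rw [hw2]; linear_combination (-8 * w - 4) * hw
  have e8 : (w + w + w ^ 2) ^ 3 = 3 + 6 * w := by
    rw [hw2]; linear_combination (w - 4) * hw
  have e9 : (w + w ^ 2 + w ^ 2) ^ 3 = -(3 + 6 * w) := by
    rw [hw2]; linear_combination (-w - 5) * hw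
  have e10 : (1 + w + w ^ 2) ^ 3 = 0 := by
    rw [hw2]; ring
  simp only [pow_mul _ 3 n, e1, e2, e3, e4, e5, e6, e7, e8, e9, e10] at hc
  rw [eq_div_iff hf] at hc
  rw [CC_eq_coeff, eq_div_iff (by norm_num)]
  generalize (27 : ℂ) ^ n = A at *
  generalize (3 + 6 * w) ^ n = P at *
  generalize (-(3 + 6 * w)) ^ n = Q at *
  generalize (0 : ℂ) ^ n = Z at *
  linear_combination hc / 3 + ((w ^ 3 + 2) * A / 3 + 6 * Z / 3 + w ^ 2 * Q + 2 * w * P) * h3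

theorem stmt_7 (x : ℝ) (hx : |x| < 1 / 27) :
    HasSum (fun n : ℕ => (CC n : ℝ) * x ^ n)
      (18 * x ^ 2 * (5 - 9 * x) / ((1 - 27 * x) * (1 + 27 * x ^ 2))) := by
  obtain ⟨w, hw⟩ : ∃ w : ℂ, w ^ 2 + w + 1 = 0 := by
    refine ⟨Complex.exp (2 * Real.pi * Complex.I / 3), ?_⟩
    have h := (Complex.isPrimitiveRoot_exp 3 three_ne_zero).geom_sum_eq_zero (by norm_num)
    simp only [Finset.sum_range_succ, Finset.sum_range_zero, Nat.cast_ofNat] at h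
    linear_combination h
  set t : ℂ := 3 + 6 * w with ht
  have ht2 : t ^ 2 = -27 := by rw [ht]; linear_combination 36 * hw
  have htn : ‖t‖ ≤ 27 := by
    have : ‖t‖ ^ 2 = 27 := by rw [← norm_pow, ht2]; simp
    nlinarith [norm_nonneg t]
  have hbound : ∀ z : ℂ, ‖z‖ ≤ 27 → ‖z * (x : ℂ)‖ < 1 := by
    intro z hz
    rw [norm_mul, Complex.norm_real, Real.norm_eq_abs]
    nlinarith [abs_nonneg x, norm_nonneg z]
  have hgeom : ∀ z : ℂ, ‖z‖ ≤ 27 → HasSum (fun n : ℕ => z ^ n * (x : ℂ) ^ n) (1 - z * x)⁻¹ := by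
    intro z hz
    simpa only [mul_pow] using hasSum_geometric_of_norm_lt_one (hbound z hz)
  have hne : ∀ z : ℂ, ‖z‖ ≤ 27 → 1 - z * (x : ℂ) ≠ 0 := by
    intro z hz h
    have := hbound z hz
    rw [← sub_eq_zero.mp h] at this
    simp at this
  have h27 : ‖(27 : ℂ)‖ ≤ 27 := by simp
  have htn' : ‖-t‖ ≤ 27 := by rwa [norm_neg]
  rw [← Complex.hasSum_ofReal]
  have hsum := ((((hgeom 27 h27).add (((((hgeom t htn).mul_left w).add
    ((hgeom (-t) htn').mul_left (w ^ 2)))).mul_left 3)).add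
    ((hgeom 0 (by simp)).mul_left 2))).div_const 9
  convert! hsum using 1
  · funext n
    push_cast
    rw [CC_eq hw]
    ring
  · have n1 := hne 27 h27
    have n2 := hne t htn
    have n3 := hne (-t) htn'
    have n4 : (1 + 27 * (x : ℂ) ^ 2) = (1 - t * x) * (1 - -t * x) := by
      linear_combination (x : ℂ) ^ 2 * ht2
    have n5 : (1 + 27 * (x : ℂ) ^ 2) ≠ 0 := n4 ▸ mul_ne_zero n2 n3
    have hpair : w * (1 - t * x)⁻¹ + w ^ 2 * (1 - -t * x)⁻¹ =
        (-1 - 9 * x) / (1 + 27 * (x : ℂ) ^ 2) := by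
      rw [eq_div_iff n5, n4]
      linear_combination w * (1 - -t * x) * mul_inv_cancel₀ n2
        + w ^ 2 * (1 - t * x) * mul_inv_cancel₀ n3 + x * (w - w ^ 2) * ht
        + (1 + (9 - 6 * w) * x) * hw
    rw [hpair, zero_mul, sub_zero, inv_one]
    push_cast
    rw [mul_comm (27 : ℂ)] at n1 n5
    field_simp
    ring
end

section
/- For every natural number n ≥ 1, C_A(n) = 3·C_A(n−1) + 6·C_C(n−1) + 3·C_D(n−1). -/
open Nat Finset

/-- The number of words of length `m` over the alphabet `Fin 3` whose letter counts have the
residues `r` modulo 3. -/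
def wordCount (m : ℕ) (r : Fin 3 → ZMod 3) : ℕ :=
  ∑ k ∈ Finset.Nat.antidiagonalTuple 3 m with (fun i => (k i : ZMod 3)) = r,
    Nat.multinomial univ k

lemma wordCount_eq_coeff (m : ℕ) (r : Fin 3 → ZMod 3) :
    wordCount m r = ((∑ i : Fin 3, AddMonoidAlgebra.single (Pi.single i 1 : Fin 3 → ZMod 3)
      (1 : ℕ)) ^ m).coeff r := by
  rw [Finset.sum_pow_eq_sum_piAntidiag, Finset.piAntidiag_univ_fin_eq_antidiagonalTuple,
    AddMonoidAlgebra.coeff_sum, Finsupp.finsetSum_apply, wordCount, Finset.sum_filter]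
  refine Finset.sum_congr rfl fun k _ => ?_
  have h : ∏ i : Fin 3, AddMonoidAlgebra.single (Pi.single i 1 : Fin 3 → ZMod 3) (1 : ℕ) ^ k i
      = AddMonoidAlgebra.single (fun i => (k i : ZMod 3)) 1 := by
    simp_rw [AddMonoidAlgebra.single_pow, one_pow]
    rw [AddMonoidAlgebra.prod_single, Finset.prod_const_one]
    congr 1
    ext j
    simp [Finset.sum_apply, Pi.single_apply]
  rw [h, ← nsmul_eq_mul, AddMonoidAlgebra.coeff_smul_apply, AddMonoidAlgebra.coeff_single,
    Finsupp.single_apply]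
  simp

lemma wordCount_succ (m : ℕ) (r : Fin 3 → ZMod 3) :
    wordCount (m + 1) r = ∑ i, wordCount m (r - Pi.single i 1) := by
  simp_rw [wordCount_eq_coeff]
  rw [_root_.pow_succ', Finset.sum_mul, AddMonoidAlgebra.coeff_sum, Finsupp.finsetSum_apply]
  refine Finset.sum_congr rfl fun i _ => ?_
  rw [AddMonoidAlgebra.coeff_single_mul_apply, one_mul, neg_add_eq_sub]

lemma wordCount_comp_perm (m : ℕ) (r : Fin 3 → ZMod 3) (σ : Equiv.Perm (Fin 3)) :
    wordCount m (r ∘ σ) = wordCount m r := by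
  refine Finset.sum_equiv (σ.arrowCongr (Equiv.refl ℕ)) (fun k => ?_) fun k _ => ?_
  · simp only [Finset.mem_filter, Finset.Nat.mem_antidiagonalTuple, Equiv.arrowCongr_apply,
      Equiv.coe_refl, Function.id_comp]
    refine and_congr ?_ ?_
    · rw [← Equiv.sum_comp σ.symm k]; rfl
    · constructor
      · intro h
        ext i
        simpa using congrFun h (σ.symm i)
      · intro h
        ext i
        simpa using congrFun h (σ i)
  · simp only [Nat.multinomial, Equiv.arrowCongr_apply, Equiv.coe_refl, Function.comp_apply, id_eq]
    rw [Equiv.sum_comp σ.symm k, Equiv.prod_comp σ.symm fun i => (k i)!]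

lemma wordCount_three_mul (N s : ℕ) (r : Fin 3 → ℕ) (hr : ∀ i, r i < 3) (hs : ∑ i, r i = 3 * s) :
    wordCount (3 * (N + s)) (fun i => (r i : ZMod 3)) =
      ∑ k ∈ Finset.Nat.antidiagonalTuple 3 N,
        (3 * (N + s))! / ∏ i, (3 * k i + r i)! := by
  symm
  refine Finset.sum_bij' (fun k _ i => 3 * k i + r i) (fun k _ i => k i / 3) ?_ ?_ ?_ ?_ ?_
  · intro k hk
    rw [Finset.Nat.mem_antidiagonalTuple] at hk
    simp only [Finset.mem_filter, Finset.Nat.mem_antidiagonalTuple]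
    refine ⟨?_, ?_⟩
    · rw [Finset.sum_add_distrib, ← Finset.mul_sum, hk, hs]; ring
    · ext i
      have h3 : (3 : ZMod 3) = 0 := by decide
      push_cast
      rw [h3, zero_mul, zero_add]
  · intro k hk
    simp only [Finset.mem_filter, Finset.Nat.mem_antidiagonalTuple] at hk ⊢
    have h (i : Fin 3) : k i % 3 = r i := by
      have := (ZMod.natCast_eq_natCast_iff' _ _ _).1 (congrFun hk.2 i)
      rwa [Nat.mod_eq_of_lt (hr i)] at this
    simp only [Fin.sum_univ_three] at hk hs ⊢
    have := h 0
    have := h 1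
    have := h 2
    omega
  · intro k _
    ext i
    have := hr i
    dsimp only
    omega
  · intro k hk
    simp only [Finset.mem_filter] at hk
    ext i
    have := (ZMod.natCast_eq_natCast_iff' _ _ _).1 (congrFun hk.2 i)
    rw [Nat.mod_eq_of_lt (hr i)] at this
    dsimp only
    omega
  · intro k hk
    rw [Finset.Nat.mem_antidiagonalTuple] at hk
    rw [Nat.multinomial, Finset.sum_add_distrib, ← Finset.mul_sum, hk, hs, mul_add]

lemma CA_eq_wordCount (n : ℕ) : CA n = wordCount (3 * n) 0 := by
  have h := wordCount_three_mul n 0 0 (by simp) (by simp)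
  simp only [Fin.prod_univ_three, Pi.zero_apply, add_zero, Nat.cast_zero] at h
  exact h.symm

lemma CC_eq_wordCount (n : ℕ) : CC n = wordCount (3 * n) ![2, 2, 2] := by
  match n with
  | 0 => decide
  | 1 => decide
  | n + 2 =>
    have h := wordCount_three_mul n 2 ![2, 2, 2] (by decide) (by decide)
    have e : (fun i => ((![2, 2, 2] : Fin 3 → ℕ) i : ZMod 3)) = ![2, 2, 2] := by decide
    rw [e] at h
    rw [h]
    simp [CC, Fin.prod_univ_three]

lemma CD_eq_wordCount (n : ℕ) : CD n = 6 * wordCount (3 * n) ![0, 1, 2] := by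
  match n with
  | 0 => decide
  | n + 1 =>
    have h := wordCount_three_mul n 1 ![0, 1, 2] (by decide) (by decide)
    have e : (fun i => ((![0, 1, 2] : Fin 3 → ℕ) i : ZMod 3)) = ![0, 1, 2] := by decide
    rw [e] at h
    rw [h]
    simp [CD, Fin.prod_univ_three]

lemma wordCount_add_three_zero (m : ℕ) :
    wordCount (m + 3) 0 =
      3 * wordCount m 0 + 6 * wordCount m ![2, 2, 2] + 18 * wordCount m ![0, 1, 2] := by
  have perm (r : Fin 3 → ZMod 3) (h : ∃ σ : Equiv.Perm (Fin 3), r = ![0, 1, 2] ∘ σ) :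
      wordCount m r = wordCount m ![0, 1, 2] := by
    obtain ⟨σ, rfl⟩ := h
    exact wordCount_comp_perm m _ σ
  have key (i j l : Fin 3) :
      wordCount m (0 - Pi.single i 1 - Pi.single j 1 - Pi.single l 1) =
        if i = j ∧ j = l then wordCount m 0
        else if i ≠ j ∧ j ≠ l ∧ i ≠ l then wordCount m ![2, 2, 2]
        else wordCount m ![0, 1, 2] := by
    split_ifs with h₁ h₂
    · congr 1; revert i j l; decide
    · congr 1; revert i j l; decide
    · apply perm; revert i j l; decide
  simp_rw [wordCount_succ, key]
  simp [Fin.sum_univ_three]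
  ring

theorem stmt_9 (n : ℕ) (hn : 1 ≤ n) :
    CA n = 3 * CA (n - 1) + 6 * CC (n - 1) + 3 * CD (n - 1) := by
  obtain ⟨n, rfl⟩ := Nat.exists_eq_add_of_le' hn
  rw [Nat.add_sub_cancel, CA_eq_wordCount, CA_eq_wordCount, CC_eq_wordCount, CD_eq_wordCount,
    mul_add, mul_one, wordCount_add_three_zero]
  ring
end

section
/- For every natural number n ≥ 1, C_B(n) = 3·C_B(n−1) + 6·C_A(n−1) + 3·C_D(n−1). -/
open Nat Finset

/-- The sum of the three standard generators in the semiring algebra of `(ZMod 3) ^ 3`. -/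
noncomputable def letterSum : AddMonoidAlgebra ℕ (Fin 3 → ZMod 3) :=
  ∑ i, AddMonoidAlgebra.single (Pi.single i 1) 1

/-- The number of words of length `N` over three letters whose letter counts have
residues `v` modulo 3, as a coefficient of a power of `letterSum`. -/
noncomputable def residueCount (N : ℕ) (v : Fin 3 → ZMod 3) : ℕ :=
  (letterSum ^ N).coeff v

theorem residueCount_zero (v : Fin 3 → ZMod 3) :
    residueCount 0 v = if v = 0 then 1 else 0 := by
  simp [residueCount, AddMonoidAlgebra.one_def, Finsupp.single_apply, eq_comm]

theorem residueCount_succ (N : ℕ) (v : Fin 3 → ZMod 3) :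
    residueCount (N + 1) v = ∑ i, residueCount N (v - Pi.single i 1) := by
  rw [residueCount, pow_succ]
  nth_rw 2 [letterSum]
  rw [Finset.mul_sum]
  have h (i : Fin 3) :
      (letterSum ^ N * AddMonoidAlgebra.single (Pi.single i 1) 1).coeff v =
        residueCount N (v - Pi.single i 1) := by
    rw [AddMonoidAlgebra.coeff_mul_single_eq_coeff_mul (v - Pi.single i 1), mul_one, residueCount]
    intro w _
    exact eq_sub_iff_add_eq.symm
  simp [h, Finsupp.finsetSum_apply]

theorem residueCount_succ_cons (N : ℕ) (a b c : ZMod 3) :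
    residueCount (N + 1) ![a, b, c] =
      residueCount N ![a - 1, b, c] + residueCount N ![a, b - 1, c] +
        residueCount N ![a, b, c - 1] := by
  rw [residueCount_succ, Fin.sum_univ_three]
  congr 2
  · congr 1
    ext i
    fin_cases i <;> simp
  · congr 1
    ext i
    fin_cases i <;> simp
  · ext i
    fin_cases i <;> simp

theorem residueCount_comp_perm (N : ℕ) (σ : Equiv.Perm (Fin 3)) (v : Fin 3 → ZMod 3) :
    residueCount N (v ∘ σ) = residueCount N v := by
  induction N generalizing v with
  | zero =>
    have h : v ∘ σ = 0 ↔ v = 0 := by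
      simp only [funext_iff, Function.comp_apply, Pi.zero_apply]
      exact σ.forall_congr_right (q := fun i => v i = 0)
    simp [residueCount_zero, h]
  | succ N ih =>
    rw [residueCount_succ, residueCount_succ]
    refine (Finset.sum_congr rfl fun i _ => ?_).trans
      (Equiv.sum_comp σ fun i => residueCount N (v - Pi.single i 1))
    rw [← ih (v - Pi.single (σ i) 1)]
    congr 1
    ext j
    simp [Pi.single_apply]

theorem residueCount_swap_left (N : ℕ) (a b c : ZMod 3) :
    residueCount N ![b, a, c] = residueCount N ![a, b, c] := by
  rw [← residueCount_comp_perm N (Equiv.swap 0 1) ![a, b, c]]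
  congr 1
  ext i
  fin_cases i <;> rfl

theorem residueCount_swap_right (N : ℕ) (a b c : ZMod 3) :
    residueCount N ![a, c, b] = residueCount N ![a, b, c] := by
  rw [← residueCount_comp_perm N (Equiv.swap 1 2) ![a, b, c]]
  congr 1
  ext i
  fin_cases i <;> rfl

theorem residueCount_eq_sum_multinomial (N : ℕ) (v : Fin 3 → ZMod 3) :
    residueCount N v =
      ∑ k ∈ Finset.piAntidiag Finset.univ N with (fun i => (k i : ZMod 3)) = v,
        Nat.multinomial Finset.univ k := by
  have h (k : Fin 3 → ℕ) :
      ∏ i, (AddMonoidAlgebra.single (Pi.single i 1 : Fin 3 → ZMod 3) (1 : ℕ)) ^ k i =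
        AddMonoidAlgebra.single (fun i => (k i : ZMod 3)) 1 := by
    simp only [AddMonoidAlgebra.single_pow, Fin.prod_univ_three,
      AddMonoidAlgebra.single_mul_single, one_pow, mul_one]
    congr 1
    ext i
    fin_cases i <;> simp
  rw [residueCount, letterSum, Finset.sum_pow_eq_sum_piAntidiag, Finset.sum_filter]
  simp only [h, ← nsmul_eq_mul]
  simp [Finsupp.finsetSum_apply, Finsupp.single_apply]

theorem residueCount_eq_sum_antidiagonalTuple {N m : ℕ} (r : Fin 3 → ℕ) (hr : ∀ i, r i < 3)
    (hN : N = 3 * m + (r 0 + r 1 + r 2)) :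
    residueCount N (fun i => (r i : ZMod 3)) =
      ∑ k ∈ Finset.Nat.antidiagonalTuple 3 m,
        (N)! / ((3 * k 0 + r 0)! * (3 * k 1 + r 1)! * (3 * k 2 + r 2)!) := by
  rw [residueCount_eq_sum_multinomial]
  symm
  refine Finset.sum_bij' (fun k _ i => 3 * k i + r i) (fun k _ i => k i / 3) ?_ ?_ ?_ ?_ ?_
  · intro k hk
    rw [Finset.Nat.mem_antidiagonalTuple, Fin.sum_univ_three] at hk
    simp only [mem_filter, mem_piAntidiag, Fin.sum_univ_three, mem_univ, implies_true, and_true]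
    refine ⟨by omega, ?_⟩
    ext i
    have h3 : (3 : ZMod 3) = 0 := rfl
    simp [h3]
  · intro k hk
    simp only [mem_filter, mem_piAntidiag, Fin.sum_univ_three, mem_univ, implies_true, and_true,
      funext_iff, ZMod.natCast_eq_natCast_iff', Fin.forall_fin_succ] at hk hr
    rw [Finset.Nat.mem_antidiagonalTuple, Fin.sum_univ_three]
    simp at hk hr
    omega
  · intro k _
    ext i
    have := hr i
    dsimp only
    omega
  · intro k hk
    simp only [mem_filter, funext_iff, ZMod.natCast_eq_natCast_iff'] at hk
    ext i
    have := hr i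
    have := hk.2 i
    dsimp only
    omega
  · intro k hk
    rw [Finset.Nat.mem_antidiagonalTuple, Fin.sum_univ_three] at hk
    simp only [Nat.multinomial, Fin.sum_univ_three, Fin.prod_univ_three]
    congr 2
    omega

theorem CA_eq_residueCount (n : ℕ) : CA n = residueCount (3 * n) ![0, 0, 0] := by
  have h := residueCount_eq_sum_antidiagonalTuple (N := 3 * n) (m := n) ![0, 0, 0]
    (by decide) (by simp)
  have hv : (fun i => ((![0, 0, 0] : Fin 3 → ℕ) i : ZMod 3)) = ![0, 0, 0] := by decide
  rw [hv] at h
  rw [h]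
  rfl

theorem CB_eq_residueCount (n : ℕ) : CB n = residueCount (3 * n) ![1, 1, 1] := by
  rcases n with _ | n
  · rw [mul_zero, residueCount_zero, if_neg (by decide)]
    rfl
  have h := residueCount_eq_sum_antidiagonalTuple (N := 3 * (n + 1)) (m := n) ![1, 1, 1]
    (by decide) (by simp [mul_add])
  have hv : (fun i => ((![1, 1, 1] : Fin 3 → ℕ) i : ZMod 3)) = ![1, 1, 1] := by decide
  rw [hv] at h
  rw [h]
  rfl

theorem CD_eq_residueCount (n : ℕ) : CD n = 6 * residueCount (3 * n) ![0, 1, 2] := by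
  rcases n with _ | n
  · rw [mul_zero, residueCount_zero, if_neg (by decide)]
    rfl
  have h := residueCount_eq_sum_antidiagonalTuple (N := 3 * (n + 1)) (m := n) ![0, 1, 2]
    (by decide) (by simp [mul_add])
  have hv : (fun i => ((![0, 1, 2] : Fin 3 → ℕ) i : ZMod 3)) = ![0, 1, 2] := by decide
  rw [hv] at h
  rw [h]
  rfl

theorem stmt_10 (n : ℕ) (hn : 1 ≤ n) :
    CB n = 3 * CB (n - 1) + 6 * CA (n - 1) + 3 * CD (n - 1) := by
  obtain ⟨n, rfl⟩ := Nat.exists_eq_add_of_le' hn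
  rw [Nat.add_sub_cancel, CB_eq_residueCount, CB_eq_residueCount, CA_eq_residueCount,
    CD_eq_residueCount, show 3 * (n + 1) = 3 * n + 1 + 1 + 1 by ring]
  have h0 : (0 : ZMod 3) - 1 = 2 := rfl
  have h1 : (1 : ZMod 3) - 1 = 0 := rfl
  have h2 : (2 : ZMod 3) - 1 = 1 := rfl
  simp only [residueCount_succ_cons, h0, h1, h2]
  have e1 := residueCount_swap_left (3 * n) 0 1 2
  have e2 := residueCount_swap_right (3 * n) 0 1 2
  have e3 := residueCount_swap_left (3 * n) 0 2 1
  have e4 := residueCount_swap_right (3 * n) 1 0 2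
  have e5 := residueCount_swap_left (3 * n) 1 2 0
  omega
end

section
/- For every natural number n ≥ 1, C_D(n) = 18·(C_D(n−1) + C_A(n−1) + C_B(n−1) + C_C(n−1)). -/
open Nat Finset

open AddMonoidAlgebra in
theorem sum_single_pow_succ (N : ℕ) :
    (∑ i : ZMod 3, single i (1 : ℕ)) ^ (N + 1) = 3 ^ N • ∑ i : ZMod 3, single i (1 : ℕ) := by
  have h (j : ZMod 3) :
      single j (1 : ℕ) * ∑ i : ZMod 3, single i (1 : ℕ) = ∑ i : ZMod 3, single i (1 : ℕ) := by
    simp only [Finset.mul_sum, single_mul_single, mul_one]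
    exact Fintype.sum_equiv (Equiv.addLeft j) _ _ fun _ => rfl
  induction N with
  | zero => simp
  | succ N ih =>
    rw [pow_succ' _ (N + 1), ih, mul_smul_comm, Finset.sum_mul, Finset.sum_congr rfl fun j _ => h j]
    simp [pow_succ 3 N, mul_smul, ZMod.card]

open AddMonoidAlgebra in
theorem sum_multinomial_filter (N : ℕ) (t : ZMod 3) :
    ∑ k ∈ Finset.Nat.antidiagonalTuple 3 (N + 1) with ((k 1 + 2 * k 2 : ℕ) : ZMod 3) = t,
      multinomial univ k = 3 ^ N := by
  have h := congrArg (fun f => f.coeff t) (sum_single_pow_succ N)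
  have e : Finset.Nat.antidiagonalTuple 3 (N + 1) = piAntidiag univ (N + 1) := by
    ext k; simp [Finset.Nat.mem_antidiagonalTuple]
  have e' (k : Fin 3 → ℕ) : ∏ i : ZMod 3, single i (1 : ℕ) ^ k i =
      single ((k 1 + 2 * k 2 : ℕ) : ZMod 3) 1 := by
    change ∏ i : Fin 3, single (i : ZMod 3) (1 : ℕ) ^ k i = _
    rw [Fin.prod_univ_three]
    simp only [single_pow, single_mul_single, one_pow, mul_one]
    congr 1
    change k 0 • (0 : ZMod 3) + k 1 • (1 : ZMod 3) + k 2 • (2 : ZMod 3) = _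
    push_cast
    simp [mul_comm]
  rw [Finset.sum_pow_eq_sum_piAntidiag, Finset.sum_congr rfl fun k _ => by rw [e' k]] at h
  rw [Finset.sum_filter, e]
  simp only [← nsmul_eq_mul, coeff_sum, coeff_smul, coeff_single, Finsupp.coe_finsetSum,
    Finset.sum_apply, Finsupp.smul_apply, Finsupp.single_apply, smul_eq_mul, mul_ite, mul_one,
    mul_zero, Finset.sum_ite_eq', Finset.mem_univ, if_true] at h
  exact h

/-- The number of words of length `N` over a three-letter alphabet whose letter counts have
remainders `r` modulo 3. -/
def residueSum (N : ℕ) (r : Fin 3 → ℕ) : ℕ :=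
  ∑ k ∈ Finset.Nat.antidiagonalTuple 3 N with ∀ i, k i % 3 = r i, multinomial univ k

theorem residueSum_comp_perm (N : ℕ) (r : Fin 3 → ℕ) (σ : Equiv.Perm (Fin 3)) :
    residueSum N (r ∘ σ) = residueSum N r := by
  refine Finset.sum_equiv (σ.arrowCongr (Equiv.refl ℕ)) (fun k => ?_) fun k _ => ?_
  · simp only [Finset.mem_filter, Finset.Nat.mem_antidiagonalTuple, Equiv.arrowCongr_apply,
      Equiv.coe_refl, Function.comp_apply, id]
    rw [Equiv.sum_comp σ.symm k, σ.forall_congr_left]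
    simp
  · simp only [multinomial, Equiv.arrowCongr_apply, Equiv.coe_refl, Function.comp_apply, id]
    rw [Equiv.sum_comp σ.symm k, Equiv.prod_comp σ.symm fun i => (k i)!]

theorem sum_multinomial_three_mul_add (r : Fin 3 → ℕ) (hr : ∀ i, r i < 3) (m s : ℕ)
    (hs : ∑ i, r i = 3 * s) :
    ∑ k ∈ Finset.Nat.antidiagonalTuple 3 m, multinomial univ (fun i => 3 * k i + r i) =
      residueSum (3 * (m + s)) r := by
  refine Finset.sum_bij' (fun k _ i => 3 * k i + r i) (fun k _ i => k i / 3) ?_ ?_ ?_ ?_ ?_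
  · intro k hk
    simp only [Finset.mem_filter, Finset.Nat.mem_antidiagonalTuple] at hk ⊢
    refine ⟨by rw [Finset.sum_add_distrib, ← Finset.mul_sum, hk, hs, mul_add], fun i => ?_⟩
    have := hr i
    omega
  · intro k hk
    simp only [Finset.mem_filter, Finset.Nat.mem_antidiagonalTuple] at hk ⊢
    have h : ∑ i, k i = 3 * ∑ i, k i / 3 + ∑ i, r i := by
      rw [Finset.mul_sum, ← Finset.sum_add_distrib]
      refine Finset.sum_congr rfl fun i _ => ?_
      have := hk.2 i
      omega
    omega
  · intro k _
    funext i
    have := hr i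
    dsimp only
    omega
  · intro k hk
    funext i
    have := (Finset.mem_filter.mp hk).2 i
    dsimp only
    omega
  · simp

theorem multinomial_fin_three (k : Fin 3 → ℕ) :
    multinomial univ k = (k 0 + k 1 + k 2)! / ((k 0)! * (k 1)! * (k 2)!) := by
  simp [multinomial, Fin.sum_univ_three, Fin.prod_univ_three]

theorem sum_factorial_div_eq_residueSum (m s a b c : ℕ) (ha : a < 3) (hb : b < 3) (hc : c < 3)
    (hs : a + b + c = 3 * s) :
    ∑ k ∈ Finset.Nat.antidiagonalTuple 3 m,
      (3 * (m + s))! / ((3 * k 0 + a)! * (3 * k 1 + b)! * (3 * k 2 + c)!) =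
      residueSum (3 * (m + s)) ![a, b, c] := by
  rw [← sum_multinomial_three_mul_add ![a, b, c] (by simp [Fin.forall_fin_succ, ha, hb, hc]) m s
    (by simp [Fin.sum_univ_three, hs])]
  refine Finset.sum_congr rfl fun k hk => ?_
  rw [Finset.Nat.mem_antidiagonalTuple, Fin.sum_univ_three] at hk
  rw [multinomial_fin_three]
  have h : 3 * k 0 + a + (3 * k 1 + b) + (3 * k 2 + c) = 3 * (m + s) := by omega
  simp [h]

theorem residueSum_eq_zero {N : ℕ} {r : Fin 3 → ℕ} (h : N < ∑ i, r i) : residueSum N r = 0 := by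
  refine Finset.sum_eq_zero fun k hk => ?_
  simp only [Finset.mem_filter, Finset.Nat.mem_antidiagonalTuple] at hk
  have : ∑ i, r i ≤ ∑ i, k i := Finset.sum_le_sum fun i _ => hk.2 i ▸ Nat.mod_le _ _
  omega

theorem CA_eq_residueSum (n : ℕ) : CA n = residueSum (3 * n) ![0, 0, 0] :=
  sum_factorial_div_eq_residueSum n 0 0 0 0 (by simp) (by simp) (by simp) rfl

theorem CB_eq_residueSum (n : ℕ) : CB n = residueSum (3 * n) ![1, 1, 1] := by
  rcases n with _ | n
  · exact (residueSum_eq_zero (by simp [Fin.sum_univ_three])).symm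
  · exact sum_factorial_div_eq_residueSum n 1 1 1 1 (by simp) (by simp) (by simp) rfl

theorem CC_eq_residueSum (n : ℕ) : CC n = residueSum (3 * n) ![2, 2, 2] := by
  rcases n with _ | _ | n
  · exact (residueSum_eq_zero (by simp [Fin.sum_univ_three])).symm
  · exact (residueSum_eq_zero (by simp [Fin.sum_univ_three])).symm
  · simpa [CC] using
      sum_factorial_div_eq_residueSum n 2 2 2 2 (by simp) (by simp) (by simp) rfl

theorem CD_eq_residueSum (n : ℕ) : CD n = 6 * residueSum (3 * n) ![0, 1, 2] := by
  rcases n with _ | n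
  · rw [residueSum_eq_zero (by simp [Fin.sum_univ_three])]
    rfl
  · exact congrArg (6 * ·)
      (sum_factorial_div_eq_residueSum n 1 0 1 2 (by simp) (by simp) (by simp) rfl)

theorem natCast_zmod_three_eq_iff (m t : ℕ) : (m : ZMod 3) = t ↔ m % 3 = t % 3 :=
  ZMod.natCast_eq_natCast_iff' m t 3

theorem CA_add_CB_add_CC (n : ℕ) : CA (n + 1) + CB (n + 1) + CC (n + 1) = 3 ^ (3 * n + 2) := by
  rw [CA_eq_residueSum, CB_eq_residueSum, CC_eq_residueSum,
    ← sum_multinomial_filter (3 * n + 2) (0 : ℕ)]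
  simp only [residueSum, Finset.sum_filter, ← Finset.sum_add_distrib]
  refine Finset.sum_congr rfl fun k hk => ?_
  rw [Finset.Nat.mem_antidiagonalTuple, Fin.sum_univ_three] at hk
  simp only [natCast_zmod_three_eq_iff, Fin.forall_fin_succ, Fin.isValue]
  simp
  split_ifs <;> omega

theorem CD_succ (n : ℕ) : CD (n + 1) = 2 * 3 ^ (3 * n + 2) := by
  have h₁ : residueSum (3 * (n + 1)) ![1, 2, 0] = residueSum (3 * (n + 1)) ![0, 1, 2] := by
    rw [← residueSum_comp_perm _ ![0, 1, 2] (finRotate 3)]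
    congr 1; decide
  have h₂ : residueSum (3 * (n + 1)) ![2, 0, 1] = residueSum (3 * (n + 1)) ![0, 1, 2] := by
    rw [← residueSum_comp_perm _ ![0, 1, 2] (finRotate 3).symm]
    congr 1; decide
  have h : residueSum (3 * (n + 1)) ![0, 1, 2] + residueSum (3 * (n + 1)) ![1, 2, 0] +
      residueSum (3 * (n + 1)) ![2, 0, 1] = 3 ^ (3 * n + 2) := by
    rw [← sum_multinomial_filter (3 * n + 2) (2 : ℕ)]
    simp only [residueSum, Finset.sum_filter, ← Finset.sum_add_distrib]
    refine Finset.sum_congr rfl fun k hk => ?_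
    rw [Finset.Nat.mem_antidiagonalTuple, Fin.sum_univ_three] at hk
    simp only [natCast_zmod_three_eq_iff, Fin.forall_fin_succ, Fin.isValue]
    simp
    have h₁ : k 1 % 3 = 0 ∨ k 1 % 3 = 1 ∨ k 1 % 3 = 2 := by omega
    have h₂ : k 2 % 3 = 0 ∨ k 2 % 3 = 1 ∨ k 2 % 3 = 2 := by omega
    rcases h₁ with h₁ | h₁ | h₁ <;> rcases h₂ with h₂ | h₂ | h₂ <;>
      split_ifs <;> omega
  rw [CD_eq_residueSum]
  omega

theorem stmt_12 (n : ℕ) (hn : 1 ≤ n) :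
    CD n = 18 * (CD (n - 1) + CA (n - 1) + CB (n - 1) + CC (n - 1)) := by
  obtain ⟨n, rfl⟩ := Nat.exists_eq_add_of_le' hn
  rw [Nat.add_sub_cancel, CD_succ]
  rcases n with _ | n
  · simp [CA, CB, CC, CD, Finset.Nat.antidiagonalTuple_zero_right]
  · have h := CA_add_CB_add_CC n
    rw [CD_succ, show 3 * (n + 1) + 2 = 3 * n + 2 + 3 by ring, pow_add]
    omega
end

section
/- The sequence C_B satisfies C_B(1) = 6, C_B(2) = 90, C_B(3) = 2106, and for every natural number n ≥ 4, C_B(n) = 27·(C_B(n−1) − C_B(n−2) + 27·C_B(n−3)). -/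
open Nat Finset

theorem Derivation.iterate_twelve_pow_three {R A : Type*} [CommRing R] [CommRing A]
    [Algebra R A] (D : Derivation R A A) {x y z : A} (h0 : D x = z) (h1 : D y = x)
    (h2 : D z = y) :
    D^[12] (y ^ 3) + 27 • D^[6] (y ^ 3) = 27 • D^[9] (y ^ 3) + 729 • D^[3] (y ^ 3) := by
  have hx : D (D (D (x * x * x))) = 3 • (x * x * x) + 6 • (z * z * z) + 18 • (x * y * z) := by
    simp only [Derivation.leibniz, map_add, smul_eq_mul, h0, h1, h2]
    ring
  have hy : D (D (D (y * y * y))) = 3 • (y * y * y) + 6 • (x * x * x) + 18 • (x * y * z) := by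
    simp only [Derivation.leibniz, map_add, smul_eq_mul, h0, h1, h2]
    ring
  have hz : D (D (D (z * z * z))) = 3 • (z * z * z) + 6 • (y * y * y) + 18 • (x * y * z) := by
    simp only [Derivation.leibniz, map_add, smul_eq_mul, h0, h1, h2]
    ring
  have he : D (D (D (x * y * z))) =
      3 • (x * x * x) + 3 • (y * y * y) + 3 • (z * z * z) + 18 • (x * y * z) := by
    simp only [Derivation.leibniz, map_add, smul_eq_mul, h0, h1, h2]
    ring
  have hp : y ^ 3 = y * y * y := by ring
  simp only [Function.iterate_succ, Function.iterate_zero, Function.comp_apply, id, hp, hx, hy,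
    hz, he, map_add, map_nsmul]
  ring

namespace PowerSeries

/-- The exponential generating series of the natural numbers congruent to `r` modulo 3. -/
noncomputable def expModThree (r : ℕ) : PowerSeries ℚ :=
  mk fun n => if n % 3 = r then ((n ! : ℕ) : ℚ)⁻¹ else 0

theorem derivative_expModThree {r s : ℕ} (hr : r < 3) (hs : s = (r + 2) % 3) :
    derivative ℚ (expModThree r) = expModThree s := by
  ext n
  rw [coeff_derivative, expModThree, expModThree, coeff_mk, coeff_mk]
  have h : (n + 1) % 3 = r ↔ n % 3 = s := by omega
  simp only [h]
  split_ifs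
  · rw [Nat.factorial_succ]
    push_cast
    field_simp
  · simp

theorem derivative_iterate_twelve_expModThree_one_pow_three :
    (derivative ℚ)^[12] (expModThree 1 ^ 3) + 27 • (derivative ℚ)^[6] (expModThree 1 ^ 3) =
      27 • (derivative ℚ)^[9] (expModThree 1 ^ 3) +
        729 • (derivative ℚ)^[3] (expModThree 1 ^ 3) :=
  (derivative ℚ).iterate_twelve_pow_three (derivative_expModThree (by norm_num) rfl)
    (derivative_expModThree (by norm_num) rfl) (derivative_expModThree (by norm_num) rfl)

theorem expModThree_one_eq :
    expModThree 1 =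
      X * expand 3 three_ne_zero (mk fun k => (((3 * k + 1)! : ℕ) : ℚ)⁻¹) := by
  ext n
  rcases n with _ | n
  · simp [expModThree]
  · rw [coeff_succ_X_mul, coeff_expand, expModThree, coeff_mk]
    have h : (n + 1) % 3 = 1 ↔ 3 ∣ n := by omega
    simp only [h]
    split_ifs with hn
    · rw [coeff_mk, Nat.mul_div_cancel' hn]
    · rfl

theorem coeff_prod_fin {R : Type*} [CommSemiring R] (k n : ℕ) (g : Fin k → PowerSeries R) :
    coeff n (∏ i, g i) =
      ∑ x ∈ Finset.Nat.antidiagonalTuple k n, ∏ i, coeff (x i) (g i) := by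
  induction k generalizing n with
  | zero => cases n <;> simp [coeff_one]
  | succ k ih =>
    simp only [Fin.prod_univ_succ, coeff_mul, ih, Finset.mul_sum]
    rw [Finset.sum_sigma']
    refine Finset.sum_bij' (fun a _ => Fin.cons a.1.1 a.2)
      (fun x _ => ⟨(x 0, ∑ i, Fin.tail x i), Fin.tail x⟩) ?_ ?_ ?_ ?_ ?_
    · rintro ⟨⟨a, b⟩, y⟩ h
      simp only [Finset.mem_sigma, HasAntidiagonal.mem_antidiagonal, Finset.Nat.mem_antidiagonalTuple] at h
      simp [Finset.Nat.mem_antidiagonalTuple, Fin.sum_univ_succ, h.2, h.1]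
    · intro x h
      simpa [Finset.Nat.mem_antidiagonalTuple, Fin.sum_univ_succ, Fin.tail] using h
    · rintro ⟨⟨a, b⟩, y⟩ h
      simp only [Finset.mem_sigma, HasAntidiagonal.mem_antidiagonal, Finset.Nat.mem_antidiagonalTuple] at h
      simp [h.2]
    · intro x _
      simp
    · rintro ⟨⟨a, b⟩, y⟩ _
      simp

end PowerSeries

open PowerSeries in
theorem CB_eq_factorial_mul_coeff {n : ℕ} (hn : n ≠ 0) :
    (CB n : ℚ) = (3 * n)! * coeff (3 * n) (expModThree 1 ^ 3) := by
  obtain ⟨m, rfl⟩ := Nat.exists_eq_succ_of_ne_zero hn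
  rw [expModThree_one_eq, mul_pow, ← map_pow, show 3 * m.succ = 3 * m + 3 by omega,
    coeff_X_pow_mul, coeff_expand_mul, ← Fin.prod_const, coeff_prod_fin, Finset.mul_sum, CB,
    if_neg hn, Nat.cast_sum, Nat.succ_sub_one]
  refine Finset.sum_congr rfl fun k hk => ?_
  rw [Finset.Nat.mem_antidiagonalTuple, Fin.sum_univ_three] at hk
  have hsum : 3 * m.succ = 3 * k 0 + 1 + (3 * k 1 + 1) + (3 * k 2 + 1) := by omega
  have hdvd : (3 * k 0 + 1)! * (3 * k 1 + 1)! * (3 * k 2 + 1)! ∣ (3 * m.succ)! := by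
    rw [hsum]
    exact (mul_dvd_mul_right (Nat.factorial_mul_factorial_dvd_factorial_add _ _) _).trans
      (Nat.factorial_mul_factorial_dvd_factorial_add _ _)
  rw [Nat.cast_div hdvd (by positivity), Fin.prod_univ_three]
  simp only [coeff_mk, Nat.cast_mul, show 3 * m.succ = 3 * m + 3 by omega]
  field_simp

open PowerSeries in
theorem CB_eq_factorial_mul_coeff_iterate (m j : ℕ) (h : m + j ≠ 0) :
    (CB (m + j) : ℚ) =
      (3 * m)! * coeff (3 * m) ((derivative ℚ)^[3 * j] (expModThree 1 ^ 3)) := by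
  rw [CB_eq_factorial_mul_coeff h, coeff_iterate_derivative]
  rw [Nat.mul_add, ← Nat.factorial_mul_ascFactorial]
  push_cast
  ring

theorem stmt_14 :
    CB 1 = 6 ∧ CB 2 = 90 ∧ CB 3 = 2106 ∧
    ∀ n : ℕ, 4 ≤ n →
      (CB n : ℤ) = 27 * ((CB (n - 1) : ℤ) - CB (n - 2) + 27 * CB (n - 3)) := by
  refine ⟨?_, ?_, ?_, fun n hn => ?_⟩
  iterate 3
    simp [CB, Finset.sum, Finset.Nat.antidiagonalTuple, Multiset.Nat.antidiagonalTuple,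
      List.Nat.antidiagonalTuple, List.Nat.antidiagonal, List.range_succ, Nat.factorial]
  obtain ⟨m, rfl⟩ := Nat.exists_eq_add_of_le' hn
  have h := congrArg (fun F => ((3 * m)! : ℚ) * PowerSeries.coeff (3 * m) F)
    PowerSeries.derivative_iterate_twelve_expModThree_one_pow_three
  have h4 := CB_eq_factorial_mul_coeff_iterate m 4 (by omega)
  have h3 := CB_eq_factorial_mul_coeff_iterate m 3 (by omega)
  have h2 := CB_eq_factorial_mul_coeff_iterate m 2 (by omega)
  have h1 := CB_eq_factorial_mul_coeff_iterate m 1 (by omega)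
  simp only [map_add, map_nsmul] at h
  simp only [nsmul_eq_mul, Nat.reduceMul] at h h1 h2 h3 h4
  rw [show m + 4 - 1 = m + 3 by omega, show m + 4 - 2 = m + 2 by omega,
    show m + 4 - 3 = m + 1 by omega]
  qify
  rw [h1, h2, h3, h4]
  push_cast at h
  linear_combination h
end

section
/- For every natural number n ≥ 1, the following identity holds in the complex numbers: C_B(n) = (1/9)·x1^n − ((1 + i·√3)/6)·x2^n − ((1 − i·√3)/6)·x3^n, where x1 = 27, x2 = 3^(3/2)·i, and x3 = −3^(3/2)·i are the three roots of the polynomial x³ − 27(x² − x + 27). -/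
open Nat Finset

open PowerSeries in
theorem coeff_fin_prod_eq_sum_antidiagonalTuple {R : Type*} [CommSemiring R] (k d : ℕ)
    (f : Fin k → PowerSeries R) :
    coeff d (∏ j, f j) = ∑ l ∈ Finset.Nat.antidiagonalTuple k d, ∏ i, coeff (l i) (f i) := by
  rw [PowerSeries.coeff_prod]
  refine Finset.sum_bij' (fun l _ => ⇑l) (fun l _ => Finsupp.equivFunOnFinite.symm l) ?_ ?_ ?_ ?_ ?_
  · intro l hl
    simpa [Finset.Nat.mem_antidiagonalTuple] using hl
  · intro l hl
    simpa [Finset.Nat.mem_antidiagonalTuple] using hl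
  · intro l _
    ext i
    rfl
  · intro l _
    rfl
  · intro l _
    rfl

/-- The series `∑ X ^ k / (3 * k + 1)!`. -/
noncomputable def trisectedExp : PowerSeries ℂ :=
  PowerSeries.mk fun k => ((3 * k + 1)! : ℂ)⁻¹

theorem CB_succ_eq_coeff (n : ℕ) :
    (CB (n + 1) : ℂ) = (3 * (n + 1))! * PowerSeries.coeff n (trisectedExp ^ 3) := by
  have h := coeff_fin_prod_eq_sum_antidiagonalTuple 3 n fun _ => trisectedExp
  rw [Finset.prod_const, Finset.card_univ, Fintype.card_fin] at h
  rw [h, CB, if_neg n.succ_ne_zero, Nat.add_sub_cancel, Nat.cast_sum, Finset.mul_sum]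
  refine Finset.sum_congr rfl fun k hk => ?_
  rw [Finset.Nat.mem_antidiagonalTuple, Fin.sum_univ_three] at hk
  have hdvd : (3 * k 0 + 1)! * (3 * k 1 + 1)! * (3 * k 2 + 1)! ∣ (3 * (n + 1))! := by
    rw [show 3 * (n + 1) = (3 * k 0 + 1) + (3 * k 1 + 1) + (3 * k 2 + 1) by omega]
    exact (mul_dvd_mul_right (Nat.factorial_mul_factorial_dvd_factorial_add _ _) _).trans
      (Nat.factorial_mul_factorial_dvd_factorial_add _ _)
  rw [Nat.cast_div hdvd (Nat.cast_ne_zero.2 (by positivity))]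
  simp only [Fin.prod_univ_three, trisectedExp, PowerSeries.coeff_mk]
  push_cast
  rw [div_eq_mul_inv, mul_inv, mul_inv]

open PowerSeries in
theorem coeff_rescale_exp_mul (a b c : ℂ) (m : ℕ) :
    coeff m (rescale a (exp ℂ) * rescale b (exp ℂ) * rescale c (exp ℂ)) =
      (a + b + c) ^ m * (m ! : ℂ)⁻¹ := by
  rw [exp_mul_exp_eq_exp_add, exp_mul_exp_eq_exp_add, coeff_rescale, coeff_exp]
  simp

open PowerSeries in
theorem three_mul_X_mul_expand_trisectedExp {w : ℂ} (hw : w ^ 2 + w + 1 = 0) :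
    3 * (X * expand 3 three_ne_zero trisectedExp) =
      rescale 1 (exp ℂ) + C w ^ 2 * rescale w (exp ℂ) + C w * rescale (w ^ 2) (exp ℂ) := by
  have hw3 : w ^ 3 = 1 := by linear_combination (w - 1) * hw
  ext m
  rw [show (3 : PowerSeries ℂ) = C (3 : ℂ) from (map_ofNat C 3).symm, ← map_pow]
  simp only [map_add, coeff_C_mul, coeff_rescale, coeff_exp]
  obtain ⟨q, rfl | rfl | rfl⟩ : ∃ q, m = 3 * q ∨ m = 3 * q + 1 ∨ m = 3 * q + 2 :=
    ⟨m / 3, by omega⟩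
  · have h0 : coeff (3 * q) (X * expand 3 three_ne_zero trisectedExp) = 0 := by
      cases q with
      | zero => simp
      | succ q =>
        rw [show 3 * (q + 1) = (3 * q + 2) + 1 by ring, coeff_succ_X_mul]
        exact coeff_expand_of_not_dvd _ _ _ (by omega)
    rw [h0, ← pow_mul, show 2 * (3 * q) = 3 * (2 * q) by ring]
    simp only [pow_mul w 3, hw3, one_pow]
    linear_combination (-(algebraMap ℚ ℂ (1 / ((3 * q)! : ℚ)))) * hw
  · rw [coeff_succ_X_mul, coeff_expand_mul, trisectedExp, coeff_mk, ← pow_mul,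
      show 2 * (3 * q + 1) = 3 * (2 * q) + 2 by ring]
    simp only [pow_add, pow_mul w 3, hw3, one_pow]
    simp only [one_div, map_inv₀, map_natCast]
    linear_combination (-2 * ((3 * q + 1)! : ℂ)⁻¹) * hw3
  · have h2 : coeff (3 * q + 2) (X * expand 3 three_ne_zero trisectedExp) = 0 := by
      rw [coeff_succ_X_mul]
      exact coeff_expand_of_not_dvd _ _ _ (by omega)
    rw [h2, ← pow_mul, show 2 * (3 * q + 2) = 3 * (2 * q + 1) + 1 by ring]
    simp only [pow_add, pow_mul w 3, hw3, one_pow]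
    linear_combination (-(algebraMap ℚ ℂ (1 / ((3 * q + 2)! : ℚ)))) * (hw + w * hw3)

open PowerSeries in
theorem coeff_trisectedExp_pow_three {w : ℂ} (hw : w ^ 2 + w + 1 = 0) (n : ℕ) :
    27 * coeff n (trisectedExp ^ 3) =
      (3 * 27 ^ (n + 1) + 9 * w ^ 2 * (3 + 6 * w) ^ (n + 1) + 9 * w * (-(3 + 6 * w)) ^ (n + 1)) *
        ((3 * (n + 1))! : ℂ)⁻¹ := by
  have hw3 : w ^ 3 = 1 := by linear_combination (w - 1) * hw
  have hC : (C w : PowerSeries ℂ) ^ 3 = 1 := by rw [← map_pow, hw3, map_one]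
  have hL : coeff (3 * (n + 1)) ((3 * (X * expand 3 three_ne_zero trisectedExp)) ^ 3) =
      27 * coeff n (trisectedExp ^ 3) := by
    rw [mul_pow, mul_pow, ← map_pow,
      show (3 : PowerSeries ℂ) ^ 3 = C (27 : ℂ) by rw [map_ofNat]; norm_num,
      coeff_C_mul, show 3 * (n + 1) = 3 * n + 3 by ring, coeff_X_pow_mul, coeff_expand_mul]
  have hexpand (a b c d : PowerSeries ℂ) (hd : d ^ 3 = 1) :
      (a + d ^ 2 * b + d * c) ^ 3 =
        a * a * a + b * b * b + c * c * c + C 3 * (d ^ 2 * (a * a * b + b * b * c + c * c * a)) +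
          C 3 * (d * (a * a * c + b * b * a + c * c * b)) + C 6 * (a * b * c) := by
    have h3 : (C 3 : PowerSeries ℂ) = 3 := map_ofNat _ _
    have h6 : (C 6 : PowerSeries ℂ) = 6 := map_ofNat _ _
    rw [h3, h6]
    linear_combination (b ^ 3 * (d ^ 3 + 1) + c ^ 3 + 3 * d ^ 2 * b ^ 2 * c + 3 * d * b ^ 2 * a
      + 3 * d * c ^ 2 * b + 6 * a * b * c) * hd
  rw [← hL, three_mul_X_mul_expand_trisectedExp hw, hexpand _ _ _ _ hC, ← map_pow]
  simp only [map_add, coeff_C_mul, coeff_rescale_exp_mul, pow_mul _ 3]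
  rw [show ((1 : ℂ) + 1 + 1) ^ 3 = 27 by norm_num,
    show (w + w + w) ^ 3 = 27 by linear_combination 27 * hw3,
    show (w ^ 2 + w ^ 2 + w ^ 2) ^ 3 = 27 by linear_combination 27 * (w ^ 3 + 1) * hw3,
    show (1 + 1 + w) ^ 3 = 3 + 6 * w by linear_combination (w + 5) * hw,
    show (w + w + w ^ 2) ^ 3 = 3 + 6 * w by
      linear_combination (w ^ 4 + 5 * w ^ 3 + 6 * w ^ 2 - 3 * w - 3) * hw,
    show (w ^ 2 + w ^ 2 + 1) ^ 3 = 3 + 6 * w by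
      linear_combination (8 * w ^ 4 - 8 * w ^ 3 + 12 * w ^ 2 - 4 * w - 2) * hw,
    show (1 + 1 + w ^ 2) ^ 3 = -(3 + 6 * w) by
      linear_combination (w ^ 4 - w ^ 3 + 6 * w ^ 2 - 5 * w + 11) * hw,
    show (w + w + 1) ^ 3 = -(3 + 6 * w) by
      linear_combination (8 * w + 4) * hw,
    show (w ^ 2 + w ^ 2 + w) ^ 3 = -(3 + 6 * w) by
      linear_combination (8 * w ^ 4 + 4 * w ^ 3 - 6 * w ^ 2 + 3 * w + 3) * hw,
    show 1 + w + w ^ 2 = 0 by linear_combination hw]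
  simp
  ring

theorem stmt_18 (n : ℕ) (hn : 1 ≤ n) :
    let x1 : ℂ := 27
    let x2 : ℂ := 3 * Real.sqrt 3 * Complex.I
    let x3 : ℂ := -(3 * Real.sqrt 3 * Complex.I)
    (x1 ^ 3 - 27 * (x1 ^ 2 - x1 + 27) = 0) ∧
    (x2 ^ 3 - 27 * (x2 ^ 2 - x2 + 27) = 0) ∧
    (x3 ^ 3 - 27 * (x3 ^ 2 - x3 + 27) = 0) ∧
    (CB n : ℂ) = (1 / 9) * x1 ^ n - ((1 + Complex.I * Real.sqrt 3) / 6) * x2 ^ n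
      - ((1 - Complex.I * Real.sqrt 3) / 6) * x3 ^ n := by
  intro x1 x2 x3
  have hs : (Real.sqrt 3 : ℂ) ^ 2 = 3 := by
    norm_cast
    simp
  have hI : Complex.I ^ 2 = -1 := Complex.I_sq
  have hx2 : x2 ^ 2 = -27 := by
    simp only [x2, mul_pow, hs, hI]
    norm_num
  have hx3 : x3 = -x2 := rfl
  refine ⟨by norm_num [x1], by linear_combination (x2 - 27) * hx2,
    by rw [hx3]; linear_combination (-x2 - 27) * hx2, ?_⟩
  obtain ⟨m, rfl⟩ := Nat.exists_eq_add_of_le' hn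
  obtain ⟨w, hw_def⟩ : ∃ w : ℂ, w = (-1 + Complex.I * Real.sqrt 3) / 2 := ⟨_, rfl⟩
  have hw : w ^ 2 + w + 1 = 0 := by
    rw [hw_def]
    linear_combination (Complex.I ^ 2 / 4) * hs + (3 / 4) * hI
  have hx2w : 3 + 6 * w = x2 := by
    rw [hw_def]
    ring
  have hcoeff := coeff_trisectedExp_pow_three hw m
  rw [hx2w, ← hx3] at hcoeff
  have hfac : ((3 * (m + 1))! : ℂ) ≠ 0 := by exact_mod_cast Nat.factorial_ne_zero _
  have hmain : 27 * (CB (m + 1) : ℂ) =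
      3 * 27 ^ (m + 1) + 9 * w ^ 2 * x2 ^ (m + 1) + 9 * w * x3 ^ (m + 1) := by
    rw [CB_succ_eq_coeff, mul_left_comm, hcoeff, mul_comm, inv_mul_cancel_right₀ hfac]
  have hw2 : w ^ 2 = -(1 + Complex.I * Real.sqrt 3) / 2 := by
    linear_combination hw - hw_def
  rw [hw2] at hmain
  linear_combination hmain / 27 + x3 ^ (m + 1) / 3 * hw_def
end
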